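/- arXiv:1806.00841 — 3 statements merged into one kernel-verified Lean document; each statement's English description precedes it below -/
import Mathlib

section
/- There exists a constant c > 0 such that for every countable probability vector p = (p_n)_{n≥1}, the Hausdorff dimension of the pushforward Bernoulli measure satisfies dim μ_p ≤ 1 − c. -/
open MeasureTheory Filter Set
open scoped ENNReal

instance : MeasurableSpace ℕ+ := ⊤

/-- The Gauss map `T x = 1/x - ⌊1/x⌋` (with `T 0 = 0`). -/
noncomputable def gaussMap (x : ℝ) : ℝ := if x = 0 then 0 else Int.fract x⁻¹

/-- Finite continued fraction approximants: `cfApprox n a` is the value of the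
continued fraction `1/(a 0 + 1/(a 1 + ⋯))` truncated after `n` levels. -/
noncomputable def cfApprox : ℕ → (ℕ → ℕ+) → ℝ
  | 0, _ => 0
  | n + 1, a => (((a 0 : ℕ) : ℝ) + cfApprox n (fun k => a (k + 1)))⁻¹

/-- The continued fraction coding map `Π : ℕ^ℕ → [0,1] ∖ ℚ`. -/
noncomputable def cfVal (a : ℕ → ℕ+) : ℝ := limUnder atTop (fun n => cfApprox n a)

/-- `p` is a countable probability vector `(p_n)_{n ≥ 1}`. -/
def IsProbVec (p : ℕ+ → ℝ) : Prop := (∀ n, 0 ≤ p n) ∧ HasSum p 1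

/-- `m` is the Bernoulli product measure on `ℕ^ℕ` with weights `p`:
it assigns to each cylinder the product of the weights of its digits. -/
def IsBernoulli (p : ℕ+ → ℝ) (m : Measure (ℕ → ℕ+)) : Prop :=
  ∀ (n : ℕ) (i : ℕ → ℕ+),
    m {a | ∀ k < n, a k = i k} = ENNReal.ofReal (∏ k ∈ Finset.range n, p (i k))

/-- Hausdorff dimension of a measure: `inf { dim_H A : μ A = 1 }`. -/
noncomputable def dimMeasure (μ : Measure ℝ) : ℝ≥0∞ :=
  ⨅ (A : Set ℝ) (_ : μ A = 1), dimH A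

/-- The probability, for Lebesgue measure, of the next continued fraction digit being `a`,
given that the ratio of the last two denominators of the convergents is `r`. -/
noncomputable def digitKernel (r : ℝ) (a : ℕ+) : ℝ := (1 + r) / ((a + r) * (a + 1 + r))

/-- The ratio of consecutive denominators after adding the digit `a`. -/
noncomputable def nextRatio (r : ℝ) (a : ℕ+) : ℝ := ((a : ℝ) + r)⁻¹

/-- The indicator of the digit `1`, with real values. -/
noncomputable def oneInd (a : ℕ+) : ℝ := if a = 1 then 1 else 0

/-- Blocks of three digits. -/
abbrev Block := ℕ+ × ℕ+ × ℕ+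

/-- The conditional Lebesgue probability of a block of three digits. -/
noncomputable def blockKernel (r : ℝ) (b : Block) : ℝ :=
  digitKernel r b.1 * (digitKernel (nextRatio r b.1) b.2.1 *
    digitKernel (nextRatio (nextRatio r b.1) b.2.1) b.2.2)

/-- The ratio of consecutive denominators after adding a block of three digits. -/
noncomputable def blockRatio (r : ℝ) (b : Block) : ℝ :=
  nextRatio (nextRatio (nextRatio r b.1) b.2.1) b.2.2

/-- The Bernoulli weight of a block of three digits. -/
noncomputable def blockWeight (p : ℕ+ → ℝ) (b : Block) : ℝ := p b.1 * (p b.2.1 * p b.2.2)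

lemma one_le_pnat (a : ℕ+) : (1 : ℝ) ≤ a := by exact_mod_cast a.pos

lemma two_le_pnat {a : ℕ+} (h : a ≠ 1) : (2 : ℝ) ≤ a := by
  have h1 : (a : ℕ) ≠ 1 := by simpa using h
  have h2 : 2 ≤ (a : ℕ) := by
    have := a.pos
    omega
  exact_mod_cast h2

lemma nextRatio_nonneg {r : ℝ} (hr : 0 ≤ r) (a : ℕ+) : 0 ≤ nextRatio r a := by
  unfold nextRatio; positivity

lemma nextRatio_le_one {r : ℝ} (hr : 0 ≤ r) (a : ℕ+) : nextRatio r a ≤ 1 := by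
  have := one_le_pnat a
  exact inv_le_one_of_one_le₀ (by linarith)

lemma blockRatio_nonneg {r : ℝ} (hr : 0 ≤ r) (b : Block) : 0 ≤ blockRatio r b :=
  nextRatio_nonneg (nextRatio_nonneg (nextRatio_nonneg hr _) _) _

lemma blockRatio_le_one {r : ℝ} (hr : 0 ≤ r) (b : Block) : blockRatio r b ≤ 1 :=
  nextRatio_le_one (nextRatio_nonneg (nextRatio_nonneg hr _) _) _

lemma digitKernel_nonneg {r : ℝ} (hr : 0 ≤ r) (a : ℕ+) : 0 ≤ digitKernel r a := by
  unfold digitKernel; positivity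

lemma digitKernel_le_half {r : ℝ} (hr : 0 ≤ r) (a : ℕ+) : digitKernel r a ≤ 1 / 2 := by
  have := one_le_pnat a
  unfold digitKernel
  rw [div_le_div_iff₀ (by positivity) (by norm_num)]
  nlinarith [mul_nonneg hr (sub_nonneg.2 this)]

lemma digitKernel_le_div_sq {r : ℝ} (hr : 0 ≤ r) (hr1 : r ≤ 1) (a : ℕ+) :
    digitKernel r a ≤ 2 / (a : ℝ) ^ 2 := by
  have := one_le_pnat a
  unfold digitKernel
  gcongr
  · linarith
  · rw [pow_two]
    gcongr <;> linarith

lemma digitKernel_one {r : ℝ} (hr : 0 ≤ r) : digitKernel r 1 = 1 / (2 + r) := by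
  unfold digitKernel
  field_simp
  push_cast
  ring

lemma blockKernel_nonneg {r : ℝ} (hr : 0 ≤ r) (b : Block) : 0 ≤ blockKernel r b :=
  mul_nonneg (digitKernel_nonneg hr _) (mul_nonneg (digitKernel_nonneg (nextRatio_nonneg hr _) _)
    (digitKernel_nonneg (nextRatio_nonneg (nextRatio_nonneg hr _) _) _))

lemma blockKernel_le_half {r : ℝ} (hr : 0 ≤ r) (b : Block) : blockKernel r b ≤ 1 / 2 := by
  have h1 := nextRatio_nonneg hr b.1
  have h2 := nextRatio_nonneg h1 b.2.1
  have := digitKernel_le_half hr b.1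
  have := digitKernel_le_half h1 b.2.1
  have := digitKernel_le_half h2 b.2.2
  have := digitKernel_nonneg hr b.1
  have := digitKernel_nonneg h1 b.2.1
  have := digitKernel_nonneg h2 b.2.2
  calc blockKernel r b ≤ 1 / 2 * (1 * 1) := by unfold blockKernel; gcongr <;> linarith
    _ = 1 / 2 := by norm_num

lemma hasSum_digitKernel {r : ℝ} (hr : 0 ≤ r) : HasSum (digitKernel r) 1 := by
  rw [← Equiv.pnatEquivNat.symm.hasSum_iff]
  refine (hasSum_iff_tendsto_nat_of_nonneg (f := digitKernel r ∘ Equiv.pnatEquivNat.symm)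
    (fun i => digitKernel_nonneg hr _) 1).2 ?_
  have key : ∀ n : ℕ, ∑ i ∈ Finset.range n, (digitKernel r ∘ Equiv.pnatEquivNat.symm) i
      = 1 - (1 + r) / (n + (1 + r)) := by
    intro n
    induction n with
    | zero => simp; field_simp; ring
    | succ n ih =>
      rw [Finset.sum_range_succ, ih]
      simp only [Function.comp, digitKernel, Equiv.pnatEquivNat_symm_apply, Nat.succPNat_coe]
      push_cast
      field_simp
      ring
  simp_rw [key]
  have : Tendsto (fun n : ℕ => (1 + r) / ((n : ℝ) + (1 + r))) atTop (nhds 0) :=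
    Tendsto.div_atTop tendsto_const_nhds
      (tendsto_atTop_add_const_right _ _ tendsto_natCast_atTop_atTop)
  simpa using this.const_sub 1

lemma tsum_affine_oneInd {f : ℕ+ → ℝ} (hf : ∀ a, 0 ≤ f a) (h : HasSum f 1) {α β : ℝ}
    (hα : 0 ≤ α) (hαβ : 0 ≤ α + β) :
    ∑' a, ENNReal.ofReal (f a * (α + β * oneInd a)) = ENNReal.ofReal (α + β * f 1) := by
  have h1 : HasSum (fun a => f a * (α + β * oneInd a)) (α + β * f 1) := by
    have h2 : HasSum (fun a : ℕ+ => if a = 1 then β * f 1 else 0) (β * f 1) := hasSum_ite_eq 1 _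
    have h3 := (h.mul_left α).add h2
    rw [mul_one] at h3
    refine h3.congr_fun ?_
    intro a
    unfold oneInd
    split_ifs with ha
    · subst ha; ring
    · ring
  rw [← h1.tsum_eq, ENNReal.ofReal_tsum_of_nonneg _ h1.summable]
  intro a
  refine mul_nonneg (hf a) ?_
  unfold oneInd
  split_ifs <;> simpa

lemma tsum_ofReal_eq_one {f : ℕ+ → ℝ} (hf : ∀ a, 0 ≤ f a) (h : HasSum f 1) :
    ∑' a, ENNReal.ofReal (f a) = 1 := by
  simpa using tsum_affine_oneInd hf h (α := 1) (β := 0) (by norm_num) (by norm_num)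

lemma tsum_prod_mul_le {ι κ : Type*} {F : ι → ℝ} {G : ι → κ → ℝ} {B : ι → ℝ}
    (hF : ∀ i, 0 ≤ F i) (hG : ∀ i, ∑' j, ENNReal.ofReal (G i j) ≤ ENNReal.ofReal (B i)) :
    ∑' x : ι × κ, ENNReal.ofReal (F x.1 * G x.1 x.2) ≤ ∑' i, ENNReal.ofReal (F i * B i) := by
  rw [ENNReal.tsum_prod (f := fun i j => ENNReal.ofReal (F i * G i j))]
  refine ENNReal.tsum_le_tsum fun i => ?_
  simp_rw [ENNReal.ofReal_mul (hF i)]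
  rw [ENNReal.tsum_mul_left]
  gcongr
  exact hG i

lemma tsum_prod_mul_le_one {κ : Type*} {F : ℕ+ → ℝ} {G : ℕ+ → κ → ℝ}
    (hF : ∀ i, 0 ≤ F i) (hF1 : HasSum F 1) (hG : ∀ i, ∑' j, ENNReal.ofReal (G i j) ≤ 1) :
    ∑' x : ℕ+ × κ, ENNReal.ofReal (F x.1 * G x.1 x.2) ≤ 1 := by
  refine (tsum_prod_mul_le hF (B := fun _ => 1) (by simpa using hG)).trans ?_
  simpa using (tsum_ofReal_eq_one hF hF1).le

lemma oneInd_eq_zero_or_one (a : ℕ+) : oneInd a = 0 ∨ oneInd a = 1 := by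
  unfold oneInd; split_ifs <;> simp

lemma oneInd_nonneg (a : ℕ+) : 0 ≤ oneInd a := by unfold oneInd; split_ifs <;> norm_num

lemma oneInd_le_one (a : ℕ+) : oneInd a ≤ 1 := by unfold oneInd; split_ifs <;> norm_num

/-- A family of weights whose integral against the conditional Lebesgue probabilities
is at most one. -/
lemma tsum_weight_mul_blockKernel_le_one {α β : ℕ+ → ℕ+ → ℝ} (hα : ∀ a b, 0 ≤ α a b)
    (hαβ : ∀ a b, 0 ≤ α a b + β a b)
    (h : ∀ a b r, 0 ≤ r → r ≤ 1 →
      α a b + β a b * (1 / (2 + nextRatio (nextRatio r a) b)) ≤ 1)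
    {r : ℝ} (hr : 0 ≤ r) (hr1 : r ≤ 1) :
    ∑' b : Block, ENNReal.ofReal
      ((α b.1 b.2.1 + β b.1 b.2.1 * oneInd b.2.2) * blockKernel r b) ≤ 1 := by
  have hn := fun a => nextRatio_nonneg hr a
  have hnn := fun a b => nextRatio_nonneg (hn a) b
  have key := tsum_prod_mul_le_one (F := digitKernel r)
    (G := fun a (x : ℕ+ × ℕ+) => digitKernel (nextRatio r a) x.1 *
      (digitKernel (nextRatio (nextRatio r a) x.1) x.2 * (α a x.1 + β a x.1 * oneInd x.2)))
    (digitKernel_nonneg hr) (hasSum_digitKernel hr) (by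
      intro a
      refine tsum_prod_mul_le_one (G := fun b c => digitKernel (nextRatio (nextRatio r a) b) c *
        (α a b + β a b * oneInd c)) (digitKernel_nonneg (hn a)) (hasSum_digitKernel (hn a)) ?_
      intro b
      rw [tsum_affine_oneInd (digitKernel_nonneg (hnn a b)) (hasSum_digitKernel (hnn a b))
        (hα a b) (hαβ a b), digitKernel_one (hnn a b)]
      exact ENNReal.ofReal_le_one.2 (h a b r hr hr1))
  refine le_trans (le_of_eq (tsum_congr fun b => ?_)) key
  unfold blockKernel
  congr 1
  ring

lemma inv_le_quadratic {x : ℝ} (hx : -(1 / 2) ≤ x) : 1 / (1 + x) ≤ 1 - x + 2 * x ^ 2 := by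
  rw [div_le_iff₀ (by linarith)]
  nlinarith [mul_nonneg (sq_nonneg x) (by linarith : 0 ≤ 1 + 2 * x)]

/-- The two ratios entering the last digit of a block are separated according to
whether the middle digit is `1`. -/
lemma third_digit_le {r : ℝ} (hr : 0 ≤ r) (a : ℕ+) :
    1 / (2 + nextRatio (nextRatio r a) 1) ≤ 2 / 5 := by
  have h0 := nextRatio_nonneg hr a
  have h1 := nextRatio_le_one hr a
  have : 1 / 2 ≤ nextRatio (nextRatio r a) 1 := by
    unfold nextRatio at *
    rw [one_div]
    apply inv_anti₀ (by positivity)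
    push_cast
    linarith
  rw [div_le_div_iff₀ (by linarith) (by norm_num)]
  linarith

lemma le_third_digit {r : ℝ} (hr : 0 ≤ r) (hr1 : r ≤ 1) (a : ℕ+) {b : ℕ+} (hb : b ≠ 1) :
    2 / 5 + oneInd a / 60 ≤ 1 / (2 + nextRatio (nextRatio r a) b) := by
  have h0 := nextRatio_nonneg hr a
  have hb := two_le_pnat hb
  have h2 := nextRatio_nonneg h0 b
  unfold oneInd
  split_ifs with ha
  · subst ha
    have h1 : 1 / 2 ≤ nextRatio r 1 := by
      unfold nextRatio
      rw [one_div]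
      apply inv_anti₀ (by positivity)
      push_cast
      linarith
    have h3 : nextRatio (nextRatio r 1) b ≤ 2 / 5 := by
      rw [nextRatio, inv_le_comm₀ (by linarith) (by norm_num)]
      linarith
    rw [le_div_iff₀ (by linarith)]
    linarith
  · have h3 : nextRatio (nextRatio r a) b ≤ 1 / 2 := by
      rw [nextRatio, inv_le_comm₀ (by linarith) (by norm_num)]
      linarith
    rw [le_div_iff₀ (by linarith)]
    linarith

lemma tsum_blockWeight_affine_le {p : ℕ+ → ℝ} (hp : IsProbVec p) {α β : ℕ+ → ℕ+ → ℝ}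
    {α₁ β₁ : ℕ+ → ℝ} {α₀ β₀ : ℝ} (hα : ∀ a b, 0 ≤ α a b) (hαβ : ∀ a b, 0 ≤ α a b + β a b)
    (hα₁ : ∀ a, 0 ≤ α₁ a) (hαβ₁ : ∀ a, 0 ≤ α₁ a + β₁ a) (hα₀ : 0 ≤ α₀) (hαβ₀ : 0 ≤ α₀ + β₀)
    (h₁ : ∀ a b, α a b + β a b * p 1 = α₁ a + β₁ a * oneInd b)
    (h₀ : ∀ a, α₁ a + β₁ a * p 1 = α₀ + β₀ * oneInd a) :
    ∑' b : Block, ENNReal.ofReal (blockWeight p b * (α b.1 b.2.1 + β b.1 b.2.1 * oneInd b.2.2))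
      ≤ ENNReal.ofReal (α₀ + β₀ * p 1) := by
  have key := tsum_prod_mul_le (F := p) (B := fun a => α₁ a + β₁ a * p 1)
    (G := fun a (x : ℕ+ × ℕ+) => p x.1 * (p x.2 * (α a x.1 + β a x.1 * oneInd x.2))) hp.1 (by
      intro a
      have := tsum_prod_mul_le (F := p) (B := fun b => α a b + β a b * p 1)
        (G := fun b c => p c * (α a b + β a b * oneInd c)) hp.1
        (fun b => (tsum_affine_oneInd hp.1 hp.2 (hα a b) (hαβ a b)).le)
      refine this.trans ?_
      simp_rw [h₁]
      exact (tsum_affine_oneInd hp.1 hp.2 (hα₁ a) (hαβ₁ a)).le)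
  refine (le_of_eq (tsum_congr fun b => ?_)).trans (key.trans ?_)
  · unfold blockWeight
    congr 1
    ring
  · simp_rw [h₀]
    exact (tsum_affine_oneInd hp.1 hp.2 hα₀ hαβ₀).le

/-- For every Bernoulli measure there is a weight on blocks of three digits whose conditional
Lebesgue integrals are at most one, while the Bernoulli integral of its inverse is smaller than
one by a definite amount. -/
lemma exists_separating_weight {p : ℕ+ → ℝ} (hp : IsProbVec p) :
    ∃ w : Block → ℝ, (∀ b, 0 < w b) ∧
      (∀ r, 0 ≤ r → r ≤ 1 → ∑' b, ENNReal.ofReal (w b * blockKernel r b) ≤ 1) ∧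
      ∑' b, ENNReal.ofReal (blockWeight p b * (w b)⁻¹) ≤ ENNReal.ofReal (1 - 1 / 8000000) := by
  have hq0 : 0 ≤ p 1 := hp.1 1
  have hq1 : p 1 ≤ 1 := le_hasSum hp.2 1 fun a _ => hp.1 a
  have hX0 := oneInd_nonneg
  have hX1 := oneInd_le_one
  have hw : ∀ b, 0 ≤ blockWeight p b := fun b => mul_nonneg (hp.1 _) (mul_nonneg (hp.1 _) (hp.1 _))
  have inv_bound : ∀ g : ℝ, |g| ≤ 1 →
      (1 + 1 / 4000 * g)⁻¹ ≤ 1 + 2 * (1 / 4000) ^ 2 - 1 / 4000 * g := by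
    intro g hg
    have := abs_le.1 hg
    have h := inv_le_quadratic (x := 1 / 4000 * g) (by linarith)
    rw [one_div] at h
    nlinarith
  rcases le_total (101 / 250) (p 1) with hq | hq
  · have hg : ∀ b : Block, |oneInd b.2.1 * (oneInd b.2.2 - 2 / 5)| ≤ 1 := by
      intro b
      rw [abs_mul]
      refine mul_le_one₀ ?_ (abs_nonneg _) ?_ <;> rw [abs_le] <;>
        constructor <;> linarith [hX0 b.2.1, hX0 b.2.2, hX1 b.2.1, hX1 b.2.2]
    refine ⟨fun b => 1 + 1 / 4000 * (oneInd b.2.1 * (oneInd b.2.2 - 2 / 5)),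
      fun b => by linarith [(abs_le.1 (hg b)).1], fun r hr hr1 => ?_, ?_⟩
    · have := tsum_weight_mul_blockKernel_le_one
        (α := fun _ b => 1 - 1 / 4000 * (2 / 5) * oneInd b) (β := fun _ b => 1 / 4000 * oneInd b)
        (fun a b => by linarith [hX1 b]) (fun a b => by linarith [hX1 b, hX0 b])
        (fun a b s hs hs1 => by
          unfold oneInd
          split_ifs with hb
          · subst hb
            linarith [third_digit_le hs a]
          · simp) hr hr1
      refine le_trans (le_of_eq (tsum_congr fun b => ?_)) this
      congr 1
      ring
    · have := tsum_blockWeight_affine_le hp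
        (α := fun _ b => 1 + 2 * (1 / 4000) ^ 2 + 1 / 4000 * (2 / 5) * oneInd b)
        (β := fun _ b => - (1 / 4000) * oneInd b)
        (α₁ := fun _ => 1 + 2 * (1 / 4000) ^ 2) (β₁ := fun _ => 1 / 4000 * (2 / 5 - p 1))
        (α₀ := 1 + 2 * (1 / 4000) ^ 2 + 1 / 4000 * (2 / 5 - p 1) * p 1) (β₀ := 0)
        (fun a b => by linarith [hX0 b]) (fun a b => by linarith [hX1 b, hX0 b])
        (fun a => by norm_num) (fun a => by linarith) (by nlinarith) (by nlinarith)
        (fun a b => by ring) (fun a => by ring)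
      refine le_trans (ENNReal.tsum_le_tsum fun b => ENNReal.ofReal_le_ofReal
        (mul_le_mul_of_nonneg_left ?_ (hw b))) (this.trans (ENNReal.ofReal_le_ofReal ?_))
      · refine (inv_bound _ (hg b)).trans (le_of_eq ?_)
        ring
      · nlinarith
  · have hg : ∀ b : Block, |(1 - oneInd b.2.1) * (2 / 5 + oneInd b.1 / 60 - oneInd b.2.2)| ≤ 1 := by
      intro b
      rw [abs_mul]
      refine mul_le_one₀ ?_ (abs_nonneg _) ?_ <;> rw [abs_le] <;>
        constructor <;>
        linarith [hX0 b.2.1, hX0 b.2.2, hX1 b.2.1, hX1 b.2.2, hX0 b.1, hX1 b.1]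
    refine ⟨fun b => 1 + 1 / 4000 * ((1 - oneInd b.2.1) * (2 / 5 + oneInd b.1 / 60 - oneInd b.2.2)),
      fun b => by linarith [(abs_le.1 (hg b)).1], fun r hr hr1 => ?_, ?_⟩
    · have := tsum_weight_mul_blockKernel_le_one
        (α := fun a b => 1 + 1 / 4000 * ((1 - oneInd b) * (2 / 5 + oneInd a / 60)))
        (β := fun _ b => - (1 / 4000) * (1 - oneInd b))
        (fun a b => by nlinarith [hX1 b, hX0 b, hX0 a, mul_nonneg (hX0 a) (sub_nonneg.2 (hX1 b))])
        (fun a b => by nlinarith [hX1 b, hX0 b, hX0 a, mul_nonneg (hX0 a) (sub_nonneg.2 (hX1 b))])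
        (fun a b s hs hs1 => by
          by_cases hb : b = 1
          · simp [oneInd, hb]
          · have := le_third_digit hs hs1 a hb
            have h0 : oneInd b = 0 := by simp [oneInd, hb]
            rw [h0]
            linarith) hr hr1
      refine le_trans (le_of_eq (tsum_congr fun b => ?_)) this
      congr 1
      ring
    · have := tsum_blockWeight_affine_le hp
        (α := fun a b => 1 + 2 * (1 / 4000) ^ 2 -
          1 / 4000 * ((1 - oneInd b) * (2 / 5 + oneInd a / 60)))
        (β := fun _ b => 1 / 4000 * (1 - oneInd b))
        (α₁ := fun a => 1 + 2 * (1 / 4000) ^ 2 - 1 / 4000 * (2 / 5 + oneInd a / 60 - p 1))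
        (β₁ := fun a => 1 / 4000 * (2 / 5 + oneInd a / 60 - p 1))
        (α₀ := 1 + 2 * (1 / 4000) ^ 2 - 1 / 4000 * (1 - p 1) * (2 / 5 - p 1))
        (β₀ := - (1 / 4000) * (1 - p 1) / 60)
        (fun a b => by
          rcases oneInd_eq_zero_or_one a with ha | ha <;>
            rcases oneInd_eq_zero_or_one b with hb | hb <;> rw [ha, hb] <;> norm_num)
        (fun a b => by
          rcases oneInd_eq_zero_or_one a with ha | ha <;>
            rcases oneInd_eq_zero_or_one b with hb | hb <;> rw [ha, hb] <;> norm_num)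
        (fun a => by linarith [hX1 a]) (fun a => by linarith) (by nlinarith) (by nlinarith)
        (fun a b => by ring) (fun a => by ring)
      refine le_trans (ENNReal.tsum_le_tsum fun b => ENNReal.ofReal_le_ofReal
        (mul_le_mul_of_nonneg_left ?_ (hw b))) (this.trans (ENNReal.ofReal_le_ofReal ?_))
      · refine (inv_bound _ (hg b)).trans (le_of_eq ?_)
        ring
      · nlinarith

/-- The sum of the `3/4` powers of the conditional probabilities is bounded uniformly. -/
lemma exists_tsum_blockKernel_rpow_le :
    ∃ C : ℝ, 0 ≤ C ∧ ∀ r, 0 ≤ r → r ≤ 1 →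
      ∑' b, ENNReal.ofReal (blockKernel r b ^ (3 / 4 : ℝ)) ≤ ENNReal.ofReal C := by
  set S : ℝ := ∑' a : ℕ+, 2 * (a : ℝ) ^ (-(3 / 2) : ℝ) with hS
  have hsum : Summable fun a : ℕ+ => 2 * (a : ℝ) ^ (-(3 / 2) : ℝ) :=
    ((Real.summable_nat_rpow.2 (by norm_num : -(3 / 2 : ℝ) < -1)).comp_injective
      PNat.coe_injective).mul_left 2
  have hS0 : 0 ≤ S := tsum_nonneg fun a => by positivity
  have hdigit : ∀ r, 0 ≤ r → r ≤ 1 →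
      ∑' a, ENNReal.ofReal (digitKernel r a ^ (3 / 4 : ℝ)) ≤ ENNReal.ofReal S := by
    intro r hr hr1
    rw [hS, ENNReal.ofReal_tsum_of_nonneg (fun a => by positivity) hsum]
    refine ENNReal.tsum_le_tsum fun a => ENNReal.ofReal_le_ofReal ?_
    refine (Real.rpow_le_rpow (digitKernel_nonneg hr a) (digitKernel_le_div_sq hr hr1 a)
      (by norm_num)).trans ?_
    have ha := one_le_pnat a
    rw [div_eq_mul_inv, Real.mul_rpow (by norm_num) (by positivity)]
    have h2 : (2 : ℝ) ^ (3 / 4 : ℝ) ≤ 2 := by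
      simpa using Real.rpow_le_rpow_of_exponent_le (x := 2) (by norm_num)
        (by norm_num : (3 / 4 : ℝ) ≤ 1)
    have h3 : (((a : ℝ) ^ 2)⁻¹) ^ (3 / 4 : ℝ) = (a : ℝ) ^ (-(3 / 2) : ℝ) := by
      rw [← Real.rpow_natCast, ← Real.rpow_neg (by positivity), ← Real.rpow_mul (by positivity)]
      norm_num
    rw [h3]
    gcongr
  refine ⟨S * (S * S), by positivity, fun r hr hr1 => ?_⟩
  have hn := fun a => nextRatio_nonneg hr a
  have hn1 := fun a => nextRatio_le_one hr a
  have hnn := fun a b => nextRatio_nonneg (hn a) b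
  have hnn1 := fun a b => nextRatio_le_one (hn a) b
  have scale : ∀ (f : ℕ+ → ℝ) (c : ℝ), 0 ≤ c → (∀ a, 0 ≤ f a) →
      ∑' a, ENNReal.ofReal (f a) ≤ ENNReal.ofReal S →
      ∑' a, ENNReal.ofReal (f a * c) ≤ ENNReal.ofReal (S * c) := by
    intro f c hc hf h
    simp_rw [fun a => ENNReal.ofReal_mul (hf a) (q := c)]
    rw [ENNReal.tsum_mul_right, ENNReal.ofReal_mul hS0]
    gcongr
  have hk : ∀ r, 0 ≤ r → ∀ a, 0 ≤ digitKernel r a ^ (3 / 4 : ℝ) := fun r hr a =>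
    Real.rpow_nonneg (digitKernel_nonneg hr a) _
  have key := tsum_prod_mul_le (F := fun a => digitKernel r a ^ (3 / 4 : ℝ)) (B := fun _ => S * S)
    (G := fun a (x : ℕ+ × ℕ+) => digitKernel (nextRatio r a) x.1 ^ (3 / 4 : ℝ) *
      digitKernel (nextRatio (nextRatio r a) x.1) x.2 ^ (3 / 4 : ℝ)) (hk r hr) (by
      intro a
      refine (tsum_prod_mul_le (F := fun b => digitKernel (nextRatio r a) b ^ (3 / 4 : ℝ))
        (B := fun _ => S) (G := fun b c =>
          digitKernel (nextRatio (nextRatio r a) b) c ^ (3 / 4 : ℝ)) (hk _ (hn a))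
        (fun b => hdigit _ (hnn a b) (hnn1 a b))).trans ?_
      exact scale _ _ hS0 (hk _ (hn a)) (hdigit _ (hn a) (hn1 a)))
  refine le_trans (le_of_eq (tsum_congr fun b => ?_))
    (key.trans (scale _ _ (by positivity) (hk r hr) (hdigit r hr hr1)))
  rw [blockKernel, Real.mul_rpow (digitKernel_nonneg hr _) (mul_nonneg
    (digitKernel_nonneg (hn _) _) (digitKernel_nonneg (hnn _ _) _)),
    Real.mul_rpow (digitKernel_nonneg (hn _) _) (digitKernel_nonneg (hnn _ _) _)]

/-- Interpolation between the weighted sum with exponent `1` and the unweighted sum with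
exponent `3/4`. -/
lemma tsum_weight_rpow_mul_blockKernel_rpow_le {w : Block → ℝ} (hw : ∀ b, 0 < w b) {r C θ : ℝ}
    (hr : 0 ≤ r) (hC : 0 ≤ C) (hθ : 0 ≤ θ) (hθ1 : θ ≤ 1)
    (h1 : ∑' b, ENNReal.ofReal (w b * blockKernel r b) ≤ 1)
    (h2 : ∑' b, ENNReal.ofReal (blockKernel r b ^ (3 / 4 : ℝ)) ≤ ENNReal.ofReal C) :
    ∑' b, ENNReal.ofReal (w b ^ (1 - θ) * blockKernel r b ^ (1 - θ / 4)) ≤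
      ENNReal.ofReal (1 - θ + θ * C) := by
  have hk := blockKernel_nonneg hr
  calc ∑' b, ENNReal.ofReal (w b ^ (1 - θ) * blockKernel r b ^ (1 - θ / 4))
      ≤ ∑' b, (ENNReal.ofReal (1 - θ) * ENNReal.ofReal (w b * blockKernel r b) +
          ENNReal.ofReal θ * ENNReal.ofReal (blockKernel r b ^ (3 / 4 : ℝ))) := by
        refine ENNReal.tsum_le_tsum fun b => ?_
        have h34 := Real.rpow_nonneg (hk b) (3 / 4)
        have hm := mul_nonneg (hw b).le (hk b)
        have h := Real.geom_mean_le_arith_mean2_weighted (sub_nonneg.2 hθ1) hθ hm h34 (by ring)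
        rw [← ENNReal.ofReal_mul (by linarith), ← ENNReal.ofReal_mul hθ,
          ← ENNReal.ofReal_add (mul_nonneg (by linarith) hm) (mul_nonneg hθ h34)]
        refine ENNReal.ofReal_le_ofReal (le_trans (le_of_eq ?_) h)
        rw [Real.mul_rpow (hw b).le (hk b), ← Real.rpow_mul (hk b), mul_assoc,
          ← Real.rpow_add_of_nonneg (hk b) (by linarith) (by positivity)]
        ring_nf
    _ ≤ ENNReal.ofReal (1 - θ) * 1 + ENNReal.ofReal θ * ENNReal.ofReal C := by
        rw [ENNReal.tsum_add, ENNReal.tsum_mul_left, ENNReal.tsum_mul_left]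
        gcongr
    _ = ENNReal.ofReal (1 - θ + θ * C) := by
        rw [mul_one, ← ENNReal.ofReal_mul hθ,
          ← ENNReal.ofReal_add (by linarith) (mul_nonneg hθ hC)]

/-- The Lebesgue distribution function of the remaining digits, given that the ratio of the last
two denominators is `r`. -/
noncomputable def tailDistrib (r y : ℝ) : ℝ := (1 + r) * y / (1 + r * y)

lemma tailDistrib_mem {r y : ℝ} (hr : 0 ≤ r) (hy : 0 ≤ y) (hy1 : y ≤ 1) :
    0 ≤ tailDistrib r y ∧ tailDistrib r y ≤ 1 := by
  unfold tailDistrib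
  refine ⟨by positivity, ?_⟩
  rw [div_le_one (by positivity)]
  linarith

lemma tailDistrib_inv_sub {r x y : ℝ} (hr : 0 ≤ r) (hx : 0 ≤ x) (hy : 0 ≤ y) (a : ℕ+) :
    |tailDistrib r (a + x)⁻¹ - tailDistrib r (a + y)⁻¹| =
      digitKernel r a * |tailDistrib (nextRatio r a) x - tailDistrib (nextRatio r a) y| := by
  have ha := one_le_pnat a
  have key : ∀ z, 0 ≤ z → tailDistrib r (a + z)⁻¹ = (1 + r) / (a + r + z) := by
    intro z hz
    unfold tailDistrib
    field_simp
    ring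
  have key' : ∀ z, 0 ≤ z → tailDistrib (nextRatio r a) z = (a + 1 + r) * z / (a + r + z) := by
    intro z hz
    unfold tailDistrib nextRatio
    field_simp
    ring
  rw [← abs_of_nonneg (digitKernel_nonneg hr a), ← abs_mul, key x hx, key y hy, key' x hx,
    key' y hy, ← abs_neg, digitKernel]
  congr 1
  field_simp
  ring

/-- The shift by one block of three digits. -/
def blockShift (a : ℕ → ℕ+) : ℕ → ℕ+ := fun j => a (j + 3)

/-- Words of `k` blocks. -/
abbrev BlockWord : ℕ → Type
  | 0 => PUnit
  | k + 1 => Block × BlockWord k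

/-- The first `k` blocks of a sequence. -/
def firstBlocks : (k : ℕ) → (ℕ → ℕ+) → BlockWord k
  | 0, _ => ⟨⟩
  | k + 1, a => ((a 0, a 1, a 2), firstBlocks k (blockShift a))

/-- The product of a weight over the blocks of a word. -/
noncomputable def wordProd (f : Block → ℝ) : (k : ℕ) → BlockWord k → ℝ
  | 0, _ => 1
  | k + 1, u => f u.1 * wordProd f k u.2

/-- The conditional Lebesgue probability of a word of blocks. -/
noncomputable def wordLength : (k : ℕ) → ℝ → BlockWord k → ℝ
  | 0, _, _ => 1
  | k + 1, r, u => blockKernel r u.1 * wordLength k (blockRatio r u.1) u.2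

instance instCountableBlockWord : (k : ℕ) → Countable (BlockWord k)
  | 0 => inferInstanceAs (Countable PUnit)
  | k + 1 =>
    have := instCountableBlockWord k
    inferInstanceAs (Countable (Block × BlockWord k))

lemma wordProd_nonneg {f : Block → ℝ} (hf : ∀ b, 0 ≤ f b) (k : ℕ) (u : BlockWord k) :
    0 ≤ wordProd f k u := by
  induction k with
  | zero => exact zero_le_one
  | succ k ih => exact mul_nonneg (hf _) (ih _)

lemma wordProd_pos {f : Block → ℝ} (hf : ∀ b, 0 < f b) (k : ℕ) (u : BlockWord k) :
    0 < wordProd f k u := by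
  induction k with
  | zero => exact zero_lt_one
  | succ k ih => exact mul_pos (hf _) (ih _)

lemma wordProd_mul (f g : Block → ℝ) (k : ℕ) (u : BlockWord k) :
    wordProd (fun b => f b * g b) k u = wordProd f k u * wordProd g k u := by
  induction k with
  | zero => simp [wordProd]
  | succ k ih => simp only [wordProd, ih]; ring

lemma wordProd_inv (f : Block → ℝ) (k : ℕ) (u : BlockWord k) :
    wordProd (fun b => (f b)⁻¹) k u = (wordProd f k u)⁻¹ := by
  induction k with
  | zero => simp [wordProd]
  | succ k ih => simp only [wordProd, ih, mul_inv]

lemma wordLength_nonneg (k : ℕ) {r : ℝ} (hr : 0 ≤ r) (u : BlockWord k) :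
    0 ≤ wordLength k r u := by
  induction k generalizing r with
  | zero => exact zero_le_one
  | succ k ih => exact mul_nonneg (blockKernel_nonneg hr _) (ih (blockRatio_nonneg hr _) _)

lemma wordLength_le (k : ℕ) {r : ℝ} (hr : 0 ≤ r) (u : BlockWord k) :
    wordLength k r u ≤ (1 / 2) ^ k := by
  induction k generalizing r with
  | zero => simp [wordLength]
  | succ k ih =>
    rw [pow_succ', wordLength]
    exact mul_le_mul (blockKernel_le_half hr _) (ih (blockRatio_nonneg hr _) _)
      (wordLength_nonneg k (blockRatio_nonneg hr _) _) (by norm_num)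

lemma tsum_wordProd_le {f : Block → ℝ} (hf : ∀ b, 0 ≤ f b) {σ : ℝ} (hσ : 0 ≤ σ)
    (h : ∑' b, ENNReal.ofReal (f b) ≤ ENNReal.ofReal σ) (k : ℕ) :
    ∑' u, ENNReal.ofReal (wordProd f k u) ≤ ENNReal.ofReal (σ ^ k) := by
  induction k with
  | zero => simp [wordProd, tsum_fintype]
  | succ k ih =>
    have := tsum_prod_mul_le (F := f) (G := fun _ u => wordProd f k u) (B := fun _ => σ ^ k) hf
      (fun _ => ih)
    refine this.trans ?_
    simp_rw [fun b => ENNReal.ofReal_mul (hf b) (q := σ ^ k)]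
    rw [ENNReal.tsum_mul_right, pow_succ', ENNReal.ofReal_mul hσ]
    gcongr

lemma tsum_wordProd_rpow_mul_wordLength_rpow_le {w : Block → ℝ} (hw : ∀ b, 0 < w b) {s t Λ : ℝ}
    (hΛ : 0 ≤ Λ)
    (h : ∀ r, 0 ≤ r → r ≤ 1 →
      ∑' b, ENNReal.ofReal (w b ^ t * blockKernel r b ^ s) ≤ ENNReal.ofReal Λ)
    (k : ℕ) {r : ℝ} (hr : 0 ≤ r) (hr1 : r ≤ 1) :
    ∑' u, ENNReal.ofReal (wordProd w k u ^ t * wordLength k r u ^ s) ≤ ENNReal.ofReal (Λ ^ k) := by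
  induction k generalizing r with
  | zero => simp [wordProd, wordLength, tsum_fintype]
  | succ k ih =>
    have hF : ∀ b, 0 ≤ w b ^ t * blockKernel r b ^ s := fun b =>
      mul_nonneg (Real.rpow_nonneg (hw b).le _) (Real.rpow_nonneg (blockKernel_nonneg hr b) _)
    have := tsum_prod_mul_le (F := fun b => w b ^ t * blockKernel r b ^ s)
      (G := fun b u => wordProd w k u ^ t * wordLength k (blockRatio r b) u ^ s)
      (B := fun _ => Λ ^ k) hF
      (fun b => ih (blockRatio_nonneg hr b) (blockRatio_le_one hr b))
    refine (le_of_eq (tsum_congr fun u => ?_)).trans (this.trans ?_)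
    · rw [wordProd, wordLength, Real.mul_rpow (hw _).le (wordProd_pos hw k _).le,
        Real.mul_rpow (blockKernel_nonneg hr _)
          (wordLength_nonneg k (blockRatio_nonneg hr _) _)]
      congr 1
      ring
    · simp_rw [fun b => ENNReal.ofReal_mul (hF b) (q := Λ ^ k)]
      rw [ENNReal.tsum_mul_right, pow_succ', ENNReal.ofReal_mul hΛ]
      gcongr
      exact h r hr hr1

lemma cfApprox_mem (n : ℕ) (a : ℕ → ℕ+) : 0 ≤ cfApprox n a ∧ cfApprox n a ≤ 1 := by
  induction n generalizing a with
  | zero => simp [cfApprox]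
  | succ n ih =>
    have h := (ih fun k => a (k + 1)).1
    have := one_le_pnat (a 0)
    exact ⟨by rw [cfApprox]; positivity, inv_le_one_of_one_le₀ (by linarith)⟩

lemma tailDistrib_cfApprox_sub_le (k : ℕ) {r : ℝ} (hr : 0 ≤ r) {a b : ℕ → ℕ+}
    (hab : firstBlocks k a = firstBlocks k b) (m n : ℕ) :
    |tailDistrib r (cfApprox (m + 3 * k) a) - tailDistrib r (cfApprox (n + 3 * k) b)| ≤
      wordLength k r (firstBlocks k a) := by
  induction k generalizing r a b with
  | zero =>
    have h1 := tailDistrib_mem hr (cfApprox_mem (m + 3 * 0) a).1 (cfApprox_mem (m + 3 * 0) a).2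
    have h2 := tailDistrib_mem hr (cfApprox_mem (n + 3 * 0) b).1 (cfApprox_mem (n + 3 * 0) b).2
    rw [wordLength, abs_le]
    constructor <;> linarith
  | succ k ih =>
    simp only [firstBlocks, Prod.mk.injEq] at hab
    obtain ⟨⟨h0, h1, h2⟩, h⟩ := hab
    have e : ∀ (j : ℕ) (c : ℕ → ℕ+), cfApprox (j + 3 * (k + 1)) c =
        ((c 0 : ℕ) + (((c 1 : ℕ) : ℝ) + (((c 2 : ℕ) : ℝ) +
          cfApprox (j + 3 * k) (blockShift c))⁻¹)⁻¹ : ℝ)⁻¹ := fun j c => rfl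
    have hx := (cfApprox_mem (m + 3 * k) (blockShift a)).1
    have hy := (cfApprox_mem (n + 3 * k) (blockShift b)).1
    have hn := nextRatio_nonneg hr (b 0)
    have hnn := nextRatio_nonneg hn (b 1)
    rw [e, e, firstBlocks, wordLength, h0, h1, h2,
      tailDistrib_inv_sub hr (by positivity) (by positivity),
      tailDistrib_inv_sub hn (by positivity) (by positivity),
      tailDistrib_inv_sub hnn hx hy, ← mul_assoc, ← mul_assoc, mul_assoc (digitKernel r _)]
    exact mul_le_mul_of_nonneg_left (ih (nextRatio_nonneg hnn _) h)
      (blockKernel_nonneg hr (b 0, b 1, b 2))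

lemma abs_cfApprox_sub_le (k : ℕ) {a b : ℕ → ℕ+} (hab : firstBlocks k a = firstBlocks k b)
    {m n : ℕ} (hm : 3 * k ≤ m) (hn : 3 * k ≤ n) :
    |cfApprox m a - cfApprox n b| ≤ wordLength k 0 (firstBlocks k a) := by
  obtain ⟨m, rfl⟩ := Nat.exists_eq_add_of_le' hm
  obtain ⟨n, rfl⟩ := Nat.exists_eq_add_of_le' hn
  simpa [tailDistrib] using tailDistrib_cfApprox_sub_le k le_rfl hab m n

lemma tendsto_cfApprox (a : ℕ → ℕ+) : Tendsto (fun n => cfApprox n a) atTop (nhds (cfVal a)) := by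
  refine CauchySeq.tendsto_limUnder (Metric.cauchySeq_iff.2 fun ε hε => ?_)
  obtain ⟨k, hk⟩ := exists_pow_lt_of_lt_one hε (by norm_num : (1 / 2 : ℝ) < 1)
  refine ⟨3 * k, fun m hm n hn => ?_⟩
  rw [Real.dist_eq]
  exact ((abs_cfApprox_sub_le k rfl hm hn).trans (wordLength_le k le_rfl _)).trans_lt hk

lemma abs_cfVal_sub_le (k : ℕ) {a b : ℕ → ℕ+} (hab : firstBlocks k a = firstBlocks k b) :
    |cfVal a - cfVal b| ≤ wordLength k 0 (firstBlocks k a) :=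
  le_of_tendsto ((tendsto_cfApprox a).sub (tendsto_cfApprox b)).abs
    (eventually_atTop.2 ⟨3 * k, fun _ hn => abs_cfApprox_sub_le k hab hn hn⟩)

lemma measurable_cfApprox (n : ℕ) : Measurable (cfApprox n) := by
  induction n with
  | zero => exact measurable_const
  | succ n ih =>
    have h1 : Measurable fun a : ℕ → ℕ+ => ((a 0 : ℕ) : ℝ) :=
      (measurable_from_top (f := fun x : ℕ+ => ((x : ℕ) : ℝ))).comp (measurable_pi_apply 0)
    have h2 : Measurable fun (a : ℕ → ℕ+) (k : ℕ) => a (k + 1) :=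
      measurable_pi_lambda _ fun k => measurable_pi_apply (k + 1)
    exact (h1.add (ih.comp h2)).inv

lemma measurable_cfVal : Measurable cfVal :=
  measurable_of_tendsto_metrizable measurable_cfApprox (tendsto_pi_nhds.2 tendsto_cfApprox)

lemma firstBlocks_eq_iff (k : ℕ) (a b : ℕ → ℕ+) :
    firstBlocks k a = firstBlocks k b ↔ ∀ j < 3 * k, a j = b j := by
  induction k generalizing a b with
  | zero => simp [firstBlocks]
  | succ k ih =>
    simp only [firstBlocks, Prod.mk.injEq, ih, blockShift]
    constructor
    · rintro ⟨⟨h0, h1, h2⟩, h⟩ j hj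
      match j with
      | 0 => exact h0
      | 1 => exact h1
      | 2 => exact h2
      | j + 3 => exact h j (by omega)
    · intro h
      exact ⟨⟨h 0 (by omega), h 1 (by omega), h 2 (by omega)⟩, fun j hj => h (j + 3) (by omega)⟩

lemma wordProd_blockWeight_firstBlocks (p : ℕ+ → ℝ) (k : ℕ) (a : ℕ → ℕ+) :
    wordProd (blockWeight p) k (firstBlocks k a) = ∏ j ∈ Finset.range (3 * k), p (a j) := by
  induction k generalizing a with
  | zero => simp [wordProd]
  | succ k ih =>
    rw [wordProd, firstBlocks, ih, show 3 * (k + 1) = 3 * k + 1 + 1 + 1 by ring,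
      Finset.prod_range_succ', Finset.prod_range_succ', Finset.prod_range_succ']
    simp only [blockWeight, blockShift]
    ring

lemma measure_firstBlocks_eq_le {p : ℕ+ → ℝ} {m : Measure (ℕ → ℕ+)} (hm : IsBernoulli p m)
    (k : ℕ) (u : BlockWord k) :
    m {a | firstBlocks k a = u} ≤ ENNReal.ofReal (wordProd (blockWeight p) k u) := by
  by_cases h : ∃ a, firstBlocks k a = u
  · obtain ⟨a, rfl⟩ := h
    simp_rw [firstBlocks_eq_iff]
    rw [hm, wordProd_blockWeight_firstBlocks]
  · push Not at h
    simp [h]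

/-- Markov's inequality for the inverse of the product of weights over blocks. -/
lemma measure_wordProd_lt_le {p : ℕ+ → ℝ} (hp : ∀ a, 0 ≤ p a) {m : Measure (ℕ → ℕ+)}
    (hm : IsBernoulli p m) {w : Block → ℝ} (hw : ∀ b, 0 < w b) {σ R : ℝ} (hσ : 0 ≤ σ) (hR : 0 ≤ R)
    (h : ∑' b, ENNReal.ofReal (blockWeight p b * (w b)⁻¹) ≤ ENNReal.ofReal σ) (k : ℕ) :
    m {a | wordProd w k (firstBlocks k a) < R ^ k} ≤ ENNReal.ofReal (R * σ) ^ k := by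
  have hb : ∀ b, 0 ≤ blockWeight p b := fun b => mul_nonneg (hp _) (mul_nonneg (hp _) (hp _))
  have hterm : ∀ u : BlockWord k,
      m {a | firstBlocks k a = u ∧ wordProd w k u < R ^ k} ≤ ENNReal.ofReal (R ^ k) *
        ENNReal.ofReal (wordProd (fun b => blockWeight p b * (w b)⁻¹) k u) := by
    intro u
    by_cases hu : wordProd w k u < R ^ k
    · simp only [hu, and_true]
      refine (measure_firstBlocks_eq_le hm k u).trans ?_
      rw [← ENNReal.ofReal_mul (by positivity)]
      refine ENNReal.ofReal_le_ofReal ?_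
      have hpos := wordProd_pos hw k u
      have h0 := wordProd_nonneg hb k u
      rw [wordProd_mul, wordProd_inv, ← mul_assoc, ← div_eq_mul_inv, le_div_iff₀ hpos,
        mul_comm (R ^ k)]
      gcongr
    · simp [hu]
  calc m {a | wordProd w k (firstBlocks k a) < R ^ k}
      ≤ m (⋃ u : BlockWord k, {a | firstBlocks k a = u ∧ wordProd w k u < R ^ k}) :=
        measure_mono fun a ha => mem_iUnion.2 ⟨firstBlocks k a, rfl, ha⟩
    _ ≤ ∑' u : BlockWord k, m {a | firstBlocks k a = u ∧ wordProd w k u < R ^ k} :=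
        measure_iUnion_le _
    _ ≤ ∑' u : BlockWord k, ENNReal.ofReal (R ^ k) *
        ENNReal.ofReal (wordProd (fun b => blockWeight p b * (w b)⁻¹) k u) :=
        ENNReal.tsum_le_tsum hterm
    _ ≤ ENNReal.ofReal (R ^ k) * ENNReal.ofReal (σ ^ k) := by
        rw [ENNReal.tsum_mul_left]
        gcongr
        exact tsum_wordProd_le (fun b => mul_nonneg (hb b) (inv_nonneg.2 (hw b).le)) hσ h k
    _ = ENNReal.ofReal (R * σ) ^ k := by
        rw [← ENNReal.ofReal_mul (by positivity), ← mul_pow, ENNReal.ofReal_pow (by positivity)]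

/-- Points whose product of weights over blocks eventually grows at rate `R` form a set whose
dimension is controlled by the growth rate `Λ` of the partition sums. -/
lemma dimH_image_cfVal_le {w : Block → ℝ} (hw : ∀ b, 0 < w b) {s t Λ R : ℝ} (hs : 0 < s)
    (ht : 0 ≤ t) (hΛ : 0 ≤ Λ) (hR : 0 < R) (hΛR : Λ < R ^ t)
    (h : ∀ r, 0 ≤ r → r ≤ 1 →
      ∑' b, ENNReal.ofReal (w b ^ t * blockKernel r b ^ s) ≤ ENNReal.ofReal Λ) (N : ℕ) :
    dimH (cfVal '' {a | ∀ k, N ≤ k → R ^ k ≤ wordProd w k (firstBlocks k a)}) ≤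
      ENNReal.ofReal s := by
  set A := {a | ∀ k, N ≤ k → R ^ k ≤ wordProd w k (firstBlocks k a)}
  have hRt : 0 < R ^ t := Real.rpow_pos_of_pos hR t
  let cover : (k : ℕ) → BlockWord k → Set ℝ := fun k u =>
    cfVal '' {a | firstBlocks k a = u ∧ R ^ k ≤ wordProd w k u}
  have hdiam : ∀ k u, Metric.ediam (cover k u) ≤ ENNReal.ofReal (wordLength k 0 u) := by
    rintro k u
    refine Metric.ediam_le ?_
    rintro _ ⟨a, ⟨rfl, -⟩, rfl⟩ _ ⟨b, ⟨hb, -⟩, rfl⟩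
    rw [edist_dist, Real.dist_eq]
    exact ENNReal.ofReal_le_ofReal (abs_cfVal_sub_le k hb.symm)
  have hpow : ∀ k, (R ^ k) ^ t = (R ^ t) ^ k := fun k => by
    rw [← Real.rpow_natCast, ← Real.rpow_natCast, ← Real.rpow_mul hR.le, ← Real.rpow_mul hR.le,
      mul_comm]
  have hterm : ∀ k u, Metric.ediam (cover k u) ^ s ≤ ENNReal.ofReal (((R ^ t) ^ k)⁻¹) *
      ENNReal.ofReal (wordProd w k u ^ t * wordLength k 0 u ^ s) := by
    intro k u
    have hl := wordLength_nonneg k le_rfl u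
    by_cases hu : R ^ k ≤ wordProd w k u
    · refine (ENNReal.rpow_le_rpow (hdiam k u) hs.le).trans ?_
      rw [ENNReal.ofReal_rpow_of_nonneg hl hs.le, ← ENNReal.ofReal_mul (by positivity)]
      refine ENNReal.ofReal_le_ofReal ?_
      rw [← mul_assoc]
      refine le_mul_of_one_le_left (Real.rpow_nonneg hl s) ?_
      rw [← hpow, inv_mul_eq_div, one_le_div (by positivity)]
      exact Real.rpow_le_rpow (by positivity) hu ht
    · have : cover k u = ∅ := by simp [cover, hu]
      simp [this, hs]
  have hsum : ∀ k, ∑' u, Metric.ediam (cover k u) ^ s ≤ ENNReal.ofReal (Λ / R ^ t) ^ k := by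
    intro k
    calc ∑' u, Metric.ediam (cover k u) ^ s
        ≤ ∑' u, ENNReal.ofReal (((R ^ t) ^ k)⁻¹) *
          ENNReal.ofReal (wordProd w k u ^ t * wordLength k 0 u ^ s) :=
          ENNReal.tsum_le_tsum (hterm k)
      _ ≤ ENNReal.ofReal (((R ^ t) ^ k)⁻¹) * ENNReal.ofReal (Λ ^ k) := by
          rw [ENNReal.tsum_mul_left]
          gcongr
          exact tsum_wordProd_rpow_mul_wordLength_rpow_le hw hΛ h k le_rfl zero_le_one
      _ = ENNReal.ofReal (Λ / R ^ t) ^ k := by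
          rw [← ENNReal.ofReal_mul (by positivity), ← ENNReal.ofReal_pow (by positivity), div_pow]
          congr 1
          ring
  have hlim : Tendsto (fun k => ∑' u, Metric.ediam (cover k u) ^ s) atTop (nhds 0) := by
    refine tendsto_of_tendsto_of_tendsto_of_le_of_le tendsto_const_nhds
      (ENNReal.tendsto_pow_atTop_nhds_zero_of_lt_one ?_) (fun _ => zero_le) hsum
    exact ENNReal.ofReal_lt_one.2 ((div_lt_one hRt).2 hΛR)
  have hH : μH[s] (cfVal '' A) = 0 := by
    refine le_antisymm ?_ zero_le
    rw [← hlim.liminf_eq]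
    refine Measure.hausdorffMeasure_le_liminf_tsum s _ (fun k => ENNReal.ofReal (1 / 2) ^ k)
      (ENNReal.tendsto_pow_atTop_nhds_zero_of_lt_one (ENNReal.ofReal_lt_one.2 (by norm_num)))
      cover (Eventually.of_forall fun k u => (hdiam k u).trans ?_) ?_
    · rw [← ENNReal.ofReal_pow (by norm_num)]
      exact ENNReal.ofReal_le_ofReal (wordLength_le k le_rfl u)
    · filter_upwards [eventually_ge_atTop N] with k hk
      rintro _ ⟨a, ha, rfl⟩
      exact mem_iUnion.2 ⟨firstBlocks k a, a, ⟨rfl, ha k hk⟩, rfl⟩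
  have := dimH_le_of_hausdorffMeasure_ne_top (d := s.toNNReal) (s := cfVal '' A)
    (by rw [Real.coe_toNNReal s hs.le, hH]; simp)
  exact this

lemma exists_interpolation_exponent {C R : ℝ} (hR : 1 < R) :
    ∃ θ : ℝ, 0 < θ ∧ θ ≤ 1 ∧ 1 - θ + θ * C < R ^ (1 - θ) := by
  have h1 : ContinuousAt (fun θ : ℝ => R ^ (1 - θ) - (1 - θ + θ * C)) 0 := by
    have : ContinuousAt (fun θ : ℝ => R ^ (1 - θ)) 0 :=
      ContinuousAt.rpow continuousAt_const (by fun_prop) (Or.inl (by positivity))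
    exact this.sub (by fun_prop)
  have h2 : ∀ᶠ θ in nhds (0 : ℝ), 0 < R ^ (1 - θ) - (1 - θ + θ * C) :=
    h1.eventually_const_lt (by simpa using hR)
  obtain ⟨ε, hε, h⟩ := Metric.eventually_nhds_iff.1 h2
  refine ⟨min (ε / 2) 1, by positivity, min_le_right _ _, ?_⟩
  have := h (y := min (ε / 2) 1) (by
    rw [Real.dist_eq, sub_zero, abs_of_pos (by positivity)]
    exact (min_le_left _ _).trans_lt (by linarith))
  linarith

lemma dimMeasure_map_le_of_ae {m : Measure (ℕ → ℕ+)} [IsProbabilityMeasure m] {d : ℝ≥0∞}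
    (B : ℕ → Set (ℕ → ℕ+)) (hB : ∀ᵐ a ∂m, ∃ N, a ∈ B N) (hd : ∀ N, dimH (cfVal '' B N) ≤ d) :
    dimMeasure (m.map cfVal) ≤ d := by
  have hprob : IsProbabilityMeasure (m.map cfVal) :=
    Measure.isProbabilityMeasure_map measurable_cfVal.aemeasurable
  refine (iInf₂_le (f := fun (A : Set ℝ) (_ : m.map cfVal A = 1) => dimH A)
    (⋃ N, cfVal '' B N) (le_antisymm prob_le_one ?_)).trans ?_
  · have h1 : m {a | ∃ N, a ∈ B N} = 1 := by
      rw [measure_congr (eventuallyEq_univ.2 hB), measure_univ]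
    rw [← h1]
    refine (measure_mono ?_).trans (Measure.le_map_apply measurable_cfVal.aemeasurable _)
    rintro a ⟨N, ha⟩
    exact mem_iUnion.2 ⟨N, a, ha, rfl⟩
  · rw [dimH_iUnion]
    exact iSup_le hd

/-- **Dimension gap for the Gauss map** (Theorem 1): there is a `c > 0` such that
`dim μ_p ≤ 1 - c` for every countable probability vector `p`, where `μ_p` is the
pushforward under the continued fraction coding map of the Bernoulli measure `m_p`. -/
theorem dimension_gap :
    ∃ c : ℝ≥0∞, 0 < c ∧
      ∀ (p : ℕ+ → ℝ) (m : Measure (ℕ → ℕ+)),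
        IsProbVec p → IsProbabilityMeasure m → IsBernoulli p m →
          dimMeasure (m.map cfVal) ≤ 1 - c := by
  obtain ⟨C, hC, hC_sum⟩ := exists_tsum_blockKernel_rpow_le
  obtain ⟨θ, hθ, hθ1, hθR⟩ :=
    exists_interpolation_exponent (C := C) (by norm_num : (1 : ℝ) < 1 + 1 / 8000000)
  refine ⟨ENNReal.ofReal (θ / 4), by simpa using hθ, fun p m hp hm hpm => ?_⟩
  obtain ⟨w, hw, hw_sum, hw_inv⟩ := exists_separating_weight hp
  rw [← ENNReal.ofReal_one, ← ENNReal.ofReal_sub 1 (by positivity)]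
  refine dimMeasure_map_le_of_ae
    (fun N => {a | ∀ k, N ≤ k → (1 + 1 / 8000000) ^ k ≤ wordProd w k (firstBlocks k a)}) ?_
    (dimH_image_cfVal_le hw (by linarith) (sub_nonneg.2 hθ1)
      (add_nonneg (sub_nonneg.2 hθ1) (mul_nonneg hθ.le hC)) (by norm_num) hθR
      (fun r hr hr1 => tsum_weight_rpow_mul_blockKernel_rpow_le hw hr hC hθ.le hθ1
        (hw_sum r hr hr1) (hC_sum r hr hr1)))
  have hsum : ∑' k, m {a | wordProd w k (firstBlocks k a) < (1 + 1 / 8000000) ^ k} ≠ ⊤ := by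
    refine ne_top_of_le_ne_top ?_ (ENNReal.tsum_le_tsum
      (measure_wordProd_lt_le hp.1 hpm hw (by norm_num) (by norm_num) hw_inv))
    rw [ENNReal.tsum_geometric, Ne, ENNReal.inv_eq_top, tsub_eq_zero_iff_le, not_le,
      ENNReal.ofReal_lt_one]
    norm_num
  filter_upwards [ae_eventually_notMem hsum] with a ha
  obtain ⟨N, hN⟩ := eventually_atTop.1 ha
  exact ⟨N, fun k hk => not_lt.1 (hN k hk)⟩
end

section
/- For every ε ∈ (0, ψ) there exists η1 > 0 such that the following holds: for every probability vector p with strictly positive decreasing entries satisfying p_n = O(1/n²) (i.e., there is K > 0 with p_n ≤ K/n² for all n), if dim μ_p > 3/4 and either (p_1 ≥ ε and p_2 ≥ ε) or p_1 > ψ, then dim μ_p ≤ 1 − η1. -/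
open MeasureTheory Filter Set
open scoped ENNReal

/-- `ψ = |T'(z₁)|^{-1/4} = z₁^{1/2}`, where `z₁ = (√5 - 1)/2` is the fixed point of the
Gauss map with continued fraction expansion `(1,1,1,…)`. -/
noncomputable def psi : ℝ := Real.sqrt ((Real.sqrt 5 - 1) / 2)

/-- The conditional Lebesgue probability that the next continued fraction digit is `k`, given that
the ratio `q_{n-1} / q_n` of consecutive denominators of convergents equals `r`. -/
noncomputable def digitProb (r : ℝ) (k : ℕ+) : ℝ :=
  (1 + r) / ((((k : ℕ) : ℝ) + r) * (((k : ℕ) : ℝ) + 1 + r))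

lemma one_le_pnat_cast (k : ℕ+) : (1 : ℝ) ≤ ((k : ℕ) : ℝ) := by
  exact_mod_cast k.pos

lemma digitProb_pos {r : ℝ} (hr : 0 ≤ r) (k : ℕ+) : 0 < digitProb r k := by
  have := one_le_pnat_cast k
  unfold digitProb
  positivity

lemma digitProb_one {r : ℝ} (hr : 0 ≤ r) : digitProb r 1 = (2 + r)⁻¹ := by
  unfold digitProb
  simp only [PNat.one_coe, Nat.cast_one]
  field_simp
  ring

lemma hasSum_digitProb {r : ℝ} (hr : 0 ≤ r) : HasSum (digitProb r) 1 := by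
  rw [← Equiv.pnatEquivNat.symm.hasSum_iff,
    hasSum_iff_tendsto_nat_of_nonneg (f := digitProb r ∘ Equiv.pnatEquivNat.symm)
      (fun i => (digitProb_pos hr _).le)]
  have hpart : ∀ n : ℕ, ∑ i ∈ Finset.range n, (digitProb r ∘ Equiv.pnatEquivNat.symm) i
      = 1 - (1 + r) * ((n : ℝ) + (1 + r))⁻¹ := by
    intro n
    induction n with
    | zero => simp; field_simp; ring
    | succ n ih =>
      rw [Finset.sum_range_succ, ih]
      simp only [Function.comp, Equiv.pnatEquivNat_symm_apply, digitProb, Nat.succPNat_coe,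
        Nat.succ_eq_add_one]
      push_cast
      have : (0 : ℝ) ≤ n := n.cast_nonneg
      field_simp
      ring
  simp_rw [hpart]
  have hlim : Tendsto (fun n : ℕ => ((n : ℝ) + (1 + r))⁻¹) atTop (nhds 0) :=
    tendsto_inv_atTop_zero.comp
      (tendsto_atTop_add_const_right _ _ tendsto_natCast_atTop_atTop)
  simpa using (hlim.const_mul (1 + r)).const_sub 1

lemma digitProb_le_half {r : ℝ} (hr : 0 ≤ r) (k : ℕ+) : digitProb r k ≤ 1 / 2 := by
  have hk := one_le_pnat_cast k
  unfold digitProb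
  rw [div_le_div_iff₀ (by positivity) (by norm_num)]
  nlinarith

lemma digitProb_le_two_div_sq {r : ℝ} (hr : r ∈ Icc (0 : ℝ) 1) (k : ℕ+) :
    digitProb r k ≤ 2 / ((k : ℕ) : ℝ) ^ 2 := by
  have hk := one_le_pnat_cast k
  obtain ⟨hr0, hr1⟩ := hr
  unfold digitProb
  gcongr
  · linarith
  · nlinarith

lemma inv_add_mem_Icc {r : ℝ} (hr : 0 ≤ r) (k : ℕ+) :
    (((k : ℕ) : ℝ) + r)⁻¹ ∈ Icc (0 : ℝ) 1 := by
  have hk := one_le_pnat_cast k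
  exact ⟨by positivity, inv_le_one_of_one_le₀ (by linarith)⟩

lemma sqrt_mul_le_half_add {x y : ℝ} (hx : 0 ≤ x) (hy : 0 ≤ y) :
    √(x * y) ≤ (x + y) / 2 := by
  rw [Real.sqrt_mul hx]
  nlinarith [sq_nonneg (√x - √y), Real.sq_sqrt hx, Real.sq_sqrt hy]

lemma sqrt_mul_le_half_add_sub_sq {x y : ℝ} (hx : x ∈ Icc (0 : ℝ) 1) (hy : y ∈ Icc (0 : ℝ) 1) :
    √(x * y) ≤ (x + y) / 2 - (x - y) ^ 2 / 8 := by
  rw [Real.sqrt_mul hx.1]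
  have hx' := Real.sq_sqrt hx.1
  have hy' := Real.sq_sqrt hy.1
  have hx1 : √x ≤ 1 := Real.sqrt_le_one.2 hx.2
  have hy1 : √y ≤ 1 := Real.sqrt_le_one.2 hy.2
  have hx0 := Real.sqrt_nonneg x
  have hy0 := Real.sqrt_nonneg y
  generalize √x = u at *
  generalize √y = v at *
  subst hx' hy'
  nlinarith [mul_nonneg (sq_nonneg (u - v)) (by nlinarith : (0 : ℝ) ≤ 4 - (u + v) ^ 2)]

lemma IsProbVec.le_one {p : ℕ+ → ℝ} (hp : IsProbVec p) (k : ℕ+) : p k ≤ 1 :=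
  le_hasSum hp.2 k fun i _ => hp.1 i

lemma tsum_ofReal_le_of_hasSum {ι : Type*} {f g : ι → ℝ} {a : ℝ} (hf : ∀ i, 0 ≤ f i)
    (hfg : ∀ i, f i ≤ g i) (hg : HasSum g a) :
    ∑' i, ENNReal.ofReal (f i) ≤ ENNReal.ofReal a := by
  rw [← hg.tsum_eq, ENNReal.ofReal_tsum_of_nonneg (fun i => (hf i).trans (hfg i)) hg.summable]
  exact ENNReal.tsum_le_tsum fun i => ENNReal.ofReal_le_ofReal (hfg i)

/-- The affine combination `α (p_k + P(k)) / 2`, modified by `β` at the digit `1`, sums to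
`α + β`. -/
lemma hasSum_mean_add_single {p : ℕ+ → ℝ} (hp : IsProbVec p) {r : ℝ} (hr : 0 ≤ r) (α β : ℝ) :
    HasSum (fun k => α * ((p k + digitProb r k) / 2) + if k = 1 then β else 0) (α + β) := by
  have h1 := (((hp.2.add (hasSum_digitProb hr)).div_const 2).mul_left α).add
    (hasSum_ite_eq (1 : ℕ+) β)
  simpa using h1

lemma tsum_sqrt_mul_digitProb_le {p : ℕ+ → ℝ} (hp : IsProbVec p) {r : ℝ} (hr : 0 ≤ r) :
    ∑' k, ENNReal.ofReal √(p k * digitProb r k)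
      ≤ ENNReal.ofReal (1 - (p 1 - digitProb r 1) ^ 2 / 8) := by
  refine tsum_ofReal_le_of_hasSum (fun k => Real.sqrt_nonneg _) (fun k => ?_)
    (hasSum_mean_add_single hp hr 1 (-((p 1 - digitProb r 1) ^ 2 / 8)))
  by_cases hk : k = 1
  · subst hk
    have := sqrt_mul_le_half_add_sub_sq ⟨hp.1 1, hp.le_one 1⟩
      ⟨(digitProb_pos hr 1).le, (digitProb_le_half hr 1).trans (by norm_num)⟩
    simp only [if_true]
    linarith
  · have := sqrt_mul_le_half_add (hp.1 k) (digitProb_pos hr k).le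
    simp only [if_neg hk]
    linarith

/-- A uniform upper bound for the Hellinger affinity between two independent digits and two
consecutive continued fraction digits of a Lebesgue random point. -/
noncomputable def affinityBound : ℝ := 1 - 1 / 10 ^ 7

lemma tsum_tsum_sqrt_mul_digitProb_le {p : ℕ+ → ℝ} (hp : IsProbVec p) {r : ℝ}
    (hr : r ∈ Icc (0 : ℝ) 1) :
    ∑' k : ℕ+, ENNReal.ofReal √(p k * digitProb r k) *
      ∑' l, ENNReal.ofReal √(p l * digitProb (((k : ℕ) : ℝ) + r)⁻¹ l)
      ≤ ENNReal.ofReal affinityBound := by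
  set s : ℕ+ → ℝ := fun k => √(p k * digitProb r k) with hs
  have hs0 : ∀ k, 0 ≤ s k := fun k => Real.sqrt_nonneg _
  have hsle : ∀ k, s k ≤ (p k + digitProb r k) / 2 := fun k =>
    sqrt_mul_le_half_add (hp.1 k) (digitProb_pos hr.1 k).le
  set d : ℕ+ → ℝ := fun k => p 1 - (2 + (((k : ℕ) : ℝ) + r)⁻¹)⁻¹ with hd
  have hd1 : ∀ k, d k ^ 2 ≤ 1 := by
    intro k
    obtain ⟨h0, -⟩ := inv_add_mem_Icc hr.1 k
    have h1 : (2 + (((k : ℕ) : ℝ) + r)⁻¹)⁻¹ ≤ 1 := inv_le_one_of_one_le₀ (by linarith)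
    have h2 : 0 ≤ (2 + (((k : ℕ) : ℝ) + r)⁻¹)⁻¹ := by positivity
    have h3 := hp.1 1
    have h4 := hp.le_one 1
    simp only [hd]
    exact (sq_le_one_iff_abs_le_one _).2 (abs_le.2 ⟨by linarith, by linarith⟩)
  have hred : ∀ k : ℕ+, ENNReal.ofReal √(p k * digitProb r k) *
      ∑' l, ENNReal.ofReal √(p l * digitProb (((k : ℕ) : ℝ) + r)⁻¹ l)
      ≤ ENNReal.ofReal (s k * (1 - d k ^ 2 / 8)) := by
    intro k
    rw [ENNReal.ofReal_mul (hs0 k)]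
    have h := tsum_sqrt_mul_digitProb_le hp (inv_add_mem_Icc hr.1 k).1
    rw [digitProb_one (inv_add_mem_Icc hr.1 k).1] at h
    gcongr
  refine (ENNReal.tsum_le_tsum hred).trans ?_
  suffices ∃ α β : ℝ, α + β ≤ affinityBound ∧ ∀ k, s k * (1 - d k ^ 2 / 8) ≤
      α * ((p k + digitProb r k) / 2) + if k = 1 then β else 0 by
    obtain ⟨α, β, hαβ, hle⟩ := this
    exact (tsum_ofReal_le_of_hasSum (fun k => mul_nonneg (hs0 k) (by linarith [hd1 k])) hle
      (hasSum_mean_add_single hp hr.1 α β)).trans (ENNReal.ofReal_le_ofReal hαβ)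
  have hle1 : ∀ k, s k * (1 - d k ^ 2 / 8) ≤ s k := fun k => by
    nlinarith [hs0 k, mul_nonneg (hs0 k) (sq_nonneg (d k))]
  have hscale : ∀ k c, c ≤ d k ^ 2 / 8 →
      s k * (1 - d k ^ 2 / 8) ≤ (1 - c) * ((p k + digitProb r k) / 2) := fun k c hc =>
    calc s k * (1 - d k ^ 2 / 8)
      _ ≤ ((p k + digitProb r k) / 2) * (1 - d k ^ 2 / 8) :=
        mul_le_mul_of_nonneg_right (hsle k) (by linarith [hd1 k])
      _ ≤ (1 - c) * ((p k + digitProb r k) / 2) := by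
        have := (hs0 k).trans (hsle k)
        nlinarith
  have hr0 := hr.1
  have hr1 := hr.2
  have ha : digitProb r 1 ≤ 1 / 2 := digitProb_le_half hr0 1
  have ha' : 1 / 3 ≤ digitProb r 1 := by
    rw [digitProb_one hr0, one_div]
    exact inv_anti₀ (by linarith) (by linarith)
  have hp0 := hp.1 1
  by_cases hfar : 1 / 400 ≤ |p 1 - digitProb r 1|
  · refine ⟨1, -(1 / 1280000), by norm_num [affinityBound], fun k => (hle1 k).trans ?_⟩
    by_cases hk : k = 1
    · subst hk
      have h := sqrt_mul_le_half_add_sub_sq ⟨hp.1 1, hp.le_one 1⟩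
        ⟨(digitProb_pos hr0 1).le, ha.trans (by norm_num)⟩
      have h2 : (1 / 400 : ℝ) ^ 2 ≤ (p 1 - digitProb r 1) ^ 2 := by
        rw [← sq_abs (p 1 - _)]; gcongr
      simp only [if_true, hs]
      norm_num at h2 ⊢
      linarith
    · simpa [hk] using hsle k
  rw [not_le, abs_lt] at hfar
  rcases le_total (p 1) (31 / 80) with hp1 | hp1
  · refine ⟨1 - 1 / 51200, 1 / 51200 * ((p 1 + digitProb r 1) / 2), ?_, fun k => ?_⟩
    · norm_num [affinityBound]
      linarith
    by_cases hk : k = 1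
    · subst hk
      simp only [if_true]
      linarith [hle1 1, hsle 1]
    · simp only [if_neg hk, add_zero]
      apply hscale
      have hk2 : (2 : ℝ) ≤ ((k : ℕ) : ℝ) := by
        have : 2 ≤ (k : ℕ) := by
          have h1 := k.pos
          have h2 : (k : ℕ) ≠ 1 := fun h => hk (PNat.coe_eq_one_iff.1 h)
          omega
        exact_mod_cast this
      have h1 : (((k : ℕ) : ℝ) + r)⁻¹ ≤ 1 / 2 := by
        rw [one_div]; exact inv_anti₀ (by norm_num) (by linarith)
      have h2 : (2 / 5 : ℝ) ≤ (2 + (((k : ℕ) : ℝ) + r)⁻¹)⁻¹ := by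
        rw [show (2 / 5 : ℝ) = (5 / 2)⁻¹ by norm_num]
        exact inv_anti₀ (by positivity) (by linarith)
      simp only [hd]
      nlinarith
  · refine ⟨1, -(1 / 320000 * ((p 1 + digitProb r 1) / 2)), ?_, fun k => ?_⟩
    · norm_num [affinityBound]
      linarith
    by_cases hk : k = 1
    · subst hk
      simp only [if_true]
      have hdig : (0.385 : ℝ) ≤ (2 + r)⁻¹ := by
        rw [← digitProb_one hr0]; linarith
      rw [le_inv_comm₀ (by norm_num) (by linarith)] at hdig
      have hr6 : r ≤ 0.6 := by norm_num at hdig ⊢; linarith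
      have h1 : (0.625 : ℝ) ≤ (1 + r)⁻¹ := by
        rw [le_inv_comm₀ (by norm_num) (by linarith)]
        norm_num; linarith
      have h2 : (2 + (1 + r)⁻¹)⁻¹ ≤ (0.3825 : ℝ) := by
        rw [inv_le_comm₀ (by positivity) (by norm_num)]
        refine le_trans ?_ (add_le_add_right h1 2)
        norm_num
      have := hscale 1 (1 / 320000) (by
        simp only [hd, PNat.one_coe, Nat.cast_one]
        have h3 : 1 / 200 ≤ p 1 - (2 + (1 + r)⁻¹)⁻¹ := by linarith
        nlinarith)
      linarith
    · simp only [if_neg hk]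
      linarith [hle1 k, hsle k]

/-- The ratio `q_{n-1} / q_n` of the denominators of the last two convergents of a finite
continued fraction. -/
noncomputable def denomRatio : (n : ℕ) → (Fin n → ℕ+) → ℝ
  | 0, _ => 0
  | n + 1, w => (((w (Fin.last n) : ℕ) : ℝ) + denomRatio n (Fin.init w))⁻¹

/-- The length of the interval of points whose continued fraction expansion starts with `w`. -/
noncomputable def cylLength : (n : ℕ) → (Fin n → ℕ+) → ℝ
  | 0, _ => 1
  | n + 1, w => cylLength n (Fin.init w) * digitProb (denomRatio n (Fin.init w)) (w (Fin.last n))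

/-- The Bernoulli mass of a cylinder. -/
noncomputable def cylMass (p : ℕ+ → ℝ) (n : ℕ) (w : Fin n → ℕ+) : ℝ := ∏ i, p (w i)

lemma denomRatio_mem_Icc : ∀ (n : ℕ) (w : Fin n → ℕ+), denomRatio n w ∈ Icc (0 : ℝ) 1
  | 0, _ => by simp [denomRatio]
  | n + 1, w => inv_add_mem_Icc (denomRatio_mem_Icc n _).1 _

lemma cylLength_pos : ∀ (n : ℕ) (w : Fin n → ℕ+), 0 < cylLength n w
  | 0, _ => one_pos
  | n + 1, _ => mul_pos (cylLength_pos n _) (digitProb_pos (denomRatio_mem_Icc n _).1 _)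

lemma cylLength_le : ∀ (n : ℕ) (w : Fin n → ℕ+), cylLength n w ≤ (1 / 2) ^ n
  | 0, _ => by simp [cylLength]
  | n + 1, w => by
    rw [pow_succ]
    exact mul_le_mul (cylLength_le n _) (digitProb_le_half (denomRatio_mem_Icc n _).1 _)
      (digitProb_pos (denomRatio_mem_Icc n _).1 _).le (by positivity)

lemma cylMass_nonneg {p : ℕ+ → ℝ} (hp : IsProbVec p) (n : ℕ) (w : Fin n → ℕ+) :
    0 ≤ cylMass p n w :=
  Finset.prod_nonneg fun _ _ => hp.1 _

lemma tsum_fin_succ {α : Type*} (n : ℕ) (f : (Fin (n + 1) → α) → ℝ≥0∞) :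
    ∑' w, f w = ∑' (w : Fin n → α) (k : α), f (Fin.snoc (α := fun _ => α) w k) := by
  rw [← (Fin.snocEquiv fun _ => α).tsum_eq, ENNReal.tsum_prod', ENNReal.tsum_comm]
  rfl

lemma denomRatio_snoc (n : ℕ) (w : Fin n → ℕ+) (k : ℕ+) :
    denomRatio (n + 1) (Fin.snoc (α := fun _ => ℕ+) w k)
      = (((k : ℕ) : ℝ) + denomRatio n w)⁻¹ := by
  simp [denomRatio]

lemma cylLength_snoc (n : ℕ) (w : Fin n → ℕ+) (k : ℕ+) :
    cylLength (n + 1) (Fin.snoc (α := fun _ => ℕ+) w k)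
      = cylLength n w * digitProb (denomRatio n w) k := by
  simp [cylLength]

lemma cylMass_snoc (p : ℕ+ → ℝ) (n : ℕ) (w : Fin n → ℕ+) (k : ℕ+) :
    cylMass p (n + 1) (Fin.snoc (α := fun _ => ℕ+) w k) = cylMass p n w * p k := by
  simp [cylMass, Fin.prod_univ_castSucc]

lemma tsum_cylMass {p : ℕ+ → ℝ} (hp : IsProbVec p) (n : ℕ) :
    ∑' w, ENNReal.ofReal (cylMass p n w) = 1 := by
  induction n with
  | zero => simp [cylMass]
  | succ n ih =>
    have hp1 : ∑' k, ENNReal.ofReal (p k) = 1 := by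
      rw [← ENNReal.ofReal_tsum_of_nonneg hp.1 hp.2.summable, hp.2.tsum_eq, ENNReal.ofReal_one]
    rw [tsum_fin_succ]
    simp_rw [cylMass_snoc, ENNReal.ofReal_mul (cylMass_nonneg hp n _), ENNReal.tsum_mul_left, hp1,
      mul_one, ih]

lemma tsum_sqrt_cylMass_mul_cylLength_le {p : ℕ+ → ℝ} (hp : IsProbVec p) (j : ℕ) :
    ∑' w, ENNReal.ofReal √(cylMass p (2 * j) w * cylLength (2 * j) w)
      ≤ ENNReal.ofReal affinityBound ^ j := by
  induction j with
  | zero => simp [cylMass, cylLength]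
  | succ j ih =>
    have hsnoc : ∀ (n : ℕ) (w : Fin n → ℕ+) (k : ℕ+),
        ENNReal.ofReal √(cylMass p (n + 1) (Fin.snoc (α := fun _ => ℕ+) w k) *
          cylLength (n + 1) (Fin.snoc (α := fun _ => ℕ+) w k))
        = ENNReal.ofReal √(cylMass p n w * cylLength n w) *
          ENNReal.ofReal √(p k * digitProb (denomRatio n w) k) := by
      intro n w k
      rw [cylMass_snoc, cylLength_snoc, mul_mul_mul_comm, Real.sqrt_mul
        (mul_nonneg (cylMass_nonneg hp n w) (cylLength_pos n w).le),
        ENNReal.ofReal_mul (Real.sqrt_nonneg _)]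
    rw [show 2 * (j + 1) = 2 * j + 1 + 1 from rfl, tsum_fin_succ, tsum_fin_succ]
    simp_rw [hsnoc, denomRatio_snoc, mul_assoc, ENNReal.tsum_mul_left, pow_succ]
    refine (ENNReal.tsum_le_tsum fun w => mul_le_mul_right
      (tsum_tsum_sqrt_mul_digitProb_le hp (denomRatio_mem_Icc _ w)) _).trans ?_
    rw [ENNReal.tsum_mul_right]
    gcongr

/-- A bound for the sum of the powers of exponent `3 / 4` of the digit probabilities. -/
noncomputable def digitProbPowBound : ℝ≥0∞ :=
  ∑' k : ℕ+, ENNReal.ofReal (2 / ((k : ℕ) : ℝ) ^ 2) ^ (3 / 4 : ℝ)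

lemma digitProbPowBound_ne_top : digitProbPowBound ≠ ∞ := by
  have hs : Summable fun k : ℕ+ => (2 : ℝ) ^ (3 / 4 : ℝ) * (1 / ((k : ℕ) : ℝ) ^ (3 / 2 : ℝ)) :=
    ((Real.summable_one_div_nat_rpow.2 (by norm_num)).comp_injective
      PNat.coe_injective).mul_left _
  have h : digitProbPowBound = ∑' k : ℕ+,
      ENNReal.ofReal ((2 : ℝ) ^ (3 / 4 : ℝ) * (1 / ((k : ℕ) : ℝ) ^ (3 / 2 : ℝ))) := by
    refine tsum_congr fun k => ?_
    have hk := one_le_pnat_cast k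
    rw [ENNReal.ofReal_rpow_of_nonneg (by positivity) (by norm_num),
      Real.div_rpow (by norm_num) (by positivity), ← Real.rpow_natCast, ← Real.rpow_mul
      (by positivity), div_eq_mul_one_div]
    norm_num
  rw [h, ← ENNReal.ofReal_tsum_of_nonneg (fun k => by positivity) hs]
  exact ENNReal.ofReal_ne_top

lemma tsum_cylLength_rpow_le (n : ℕ) :
    ∑' w, ENNReal.ofReal (cylLength n w) ^ (3 / 4 : ℝ) ≤ digitProbPowBound ^ n := by
  induction n with
  | zero => simp [cylLength]
  | succ n ih =>
    rw [tsum_fin_succ]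
    simp_rw [cylLength_snoc, ENNReal.ofReal_mul (cylLength_pos n _).le,
      ENNReal.mul_rpow_of_nonneg _ _ (by norm_num : (0 : ℝ) ≤ 3 / 4), ENNReal.tsum_mul_left,
      pow_succ]
    calc _ ≤ ∑' w : Fin n → ℕ+,
          ENNReal.ofReal (cylLength n w) ^ (3 / 4 : ℝ) * digitProbPowBound := by
          refine ENNReal.tsum_le_tsum fun w => mul_le_mul_right (ENNReal.tsum_le_tsum fun k => ?_) _
          gcongr
          exact digitProb_le_two_div_sq (denomRatio_mem_Icc n w) k
      _ ≤ _ := by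
          rw [ENNReal.tsum_mul_right]
          gcongr

/-- The first `n` digits of a sequence. -/
def initialWord (n : ℕ) (a : ℕ → ℕ+) : Fin n → ℕ+ := fun i => a i

/-- The continued fraction with digits `a 0, …, a (n - 1)` and tail `t`. -/
noncomputable def cfTail : ℕ → (ℕ → ℕ+) → ℝ → ℝ
  | 0, _, t => t
  | n + 1, a, t => cfTail n a (((a n : ℕ) : ℝ) + t)⁻¹

lemma cfTail_succ' (n : ℕ) (a : ℕ → ℕ+) (t : ℝ) :
    cfTail (n + 1) a t = (((a 0 : ℕ) : ℝ) + cfTail n (fun k => a (k + 1)) t)⁻¹ := by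
  induction n generalizing t with
  | zero => rfl
  | succ n ih => exact ih _

lemma cfApprox_add (n m : ℕ) (a : ℕ → ℕ+) :
    cfApprox (n + m) a = cfTail n a (cfApprox m fun k => a (k + n)) := by
  induction n generalizing a with
  | zero => simp [cfTail]
  | succ n ih =>
    rw [cfTail_succ', Nat.succ_add, cfApprox, ih]
    simp only [Nat.add_assoc, Nat.add_comm n 1]

lemma cfApprox_mem_Icc : ∀ (n : ℕ) (a : ℕ → ℕ+), cfApprox n a ∈ Icc (0 : ℝ) 1
  | 0, _ => by simp [cfApprox]
  | n + 1, _ => inv_add_mem_Icc (cfApprox_mem_Icc n _).1 _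

lemma cfTail_congr {n : ℕ} {a b : ℕ → ℕ+} (h : initialWord n a = initialWord n b) (t : ℝ) :
    cfTail n a t = cfTail n b t := by
  induction n generalizing t with
  | zero => rfl
  | succ n ih =>
    have hn : a n = b n := congrFun h (Fin.last n)
    rw [cfTail, cfTail, hn]
    exact ih (funext fun i => congrFun h i.castSucc) _

lemma abs_cfTail_sub (n : ℕ) (a : ℕ → ℕ+) {t t' : ℝ} (ht : 0 ≤ t) (ht' : 0 ≤ t') :
    |cfTail n a t - cfTail n a t'| = |t - t'| *
      ((1 + denomRatio n (initialWord n a)) * cylLength n (initialWord n a)) /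
      ((1 + denomRatio n (initialWord n a) * t) * (1 + denomRatio n (initialWord n a) * t')) := by
  induction n generalizing t t' with
  | zero => simp [cfTail, denomRatio, cylLength]
  | succ n ih =>
    have hk := one_le_pnat_cast (a n)
    have hr := (denomRatio_mem_Icc n (initialWord n a)).1
    rw [cfTail, cfTail, ih (by positivity) (by positivity), denomRatio, cylLength]
    change _ = |t - t'| * ((1 + (((a n : ℕ) : ℝ) + denomRatio n (initialWord n a))⁻¹) *
      (cylLength n (initialWord n a) * digitProb (denomRatio n (initialWord n a)) (a n))) /
      ((1 + (((a n : ℕ) : ℝ) + denomRatio n (initialWord n a))⁻¹ * t) *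
        (1 + (((a n : ℕ) : ℝ) + denomRatio n (initialWord n a))⁻¹ * t'))
    generalize denomRatio n (initialWord n a) = r at *
    generalize cylLength n (initialWord n a) = L at *
    have hinv : |(((a n : ℕ) : ℝ) + t)⁻¹ - (((a n : ℕ) : ℝ) + t')⁻¹|
        = |t - t'| / ((((a n : ℕ) : ℝ) + t) * (((a n : ℕ) : ℝ) + t')) := by
      rw [inv_sub_inv (by positivity) (by positivity), abs_div, add_sub_add_left_eq_sub,
        abs_sub_comm, abs_of_pos (by positivity : 0 < (((a n : ℕ) : ℝ) + t) * ((a n : ℕ) + t'))]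
    rw [hinv]
    unfold digitProb
    generalize ((a n : ℕ) : ℝ) = c at *
    field_simp
    ring

lemma dist_cfTail_le {n : ℕ} {a b : ℕ → ℕ+} (h : initialWord n a = initialWord n b) {t t' : ℝ}
    (ht : t ∈ Icc (0 : ℝ) 1) (ht' : t' ∈ Icc (0 : ℝ) 1) :
    dist (cfTail n a t) (cfTail n b t') ≤ 2 * cylLength n (initialWord n a) := by
  rw [← cfTail_congr h, Real.dist_eq, abs_cfTail_sub n a ht.1 ht'.1]
  obtain ⟨hr0, hr1⟩ := denomRatio_mem_Icc n (initialWord n a)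
  have hL := cylLength_pos n (initialWord n a)
  generalize denomRatio n (initialWord n a) = r at *
  generalize cylLength n (initialWord n a) = L at *
  have h1 : |t - t'| ≤ 1 := abs_le.2 ⟨by linarith [ht.1, ht'.2], by linarith [ht.2, ht'.1]⟩
  have h2 : 1 ≤ (1 + r * t) * (1 + r * t') :=
    one_le_mul_of_one_le_of_one_le (by linarith [mul_nonneg hr0 ht.1])
      (by linarith [mul_nonneg hr0 ht'.1])
  refine (div_le_self (by positivity) h2).trans ?_
  calc |t - t'| * ((1 + r) * L) ≤ 1 * ((1 + 1) * L) := by gcongr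
    _ = 2 * L := by ring

lemma dist_cfApprox_le {n l m : ℕ} {a b : ℕ → ℕ+} (h : initialWord n a = initialWord n b)
    (hl : n ≤ l) (hm : n ≤ m) :
    dist (cfApprox l a) (cfApprox m b) ≤ 2 * cylLength n (initialWord n a) := by
  obtain ⟨l, rfl⟩ := Nat.exists_eq_add_of_le hl
  obtain ⟨m, rfl⟩ := Nat.exists_eq_add_of_le hm
  rw [cfApprox_add, cfApprox_add]
  exact dist_cfTail_le h (cfApprox_mem_Icc _ _) (cfApprox_mem_Icc _ _)

lemma dist_cfVal_le {n : ℕ} {a b : ℕ → ℕ+} (h : initialWord n a = initialWord n b) :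
    dist (cfVal a) (cfVal b) ≤ 2 * cylLength n (initialWord n a) :=
  le_of_tendsto ((tendsto_cfApprox a).dist (tendsto_cfApprox b))
    ((eventually_ge_atTop n).mono fun _ hm => dist_cfApprox_le h hm hm)

lemma IsBernoulli.measure_initialWord {p : ℕ+ → ℝ} {m : Measure (ℕ → ℕ+)} (hm : IsBernoulli p m)
    (n : ℕ) (w : Fin n → ℕ+) :
    m {a | initialWord n a = w} = ENNReal.ofReal (cylMass p n w) := by
  have h := hm n fun k => if hk : k < n then w ⟨k, hk⟩ else 1
  rw [Finset.prod_range] at h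
  simp only [Fin.is_lt, dite_true, Fin.eta] at h
  rw [cylMass, ← h]
  congr 1
  ext a
  simp only [mem_ofPred_eq, funext_iff, initialWord, Fin.forall_iff]
  refine forall₂_congr fun k hk => ?_
  rw [dif_pos hk]

lemma affinityBound_mem_Ioo : affinityBound ∈ Ioo (0 : ℝ) 1 := by
  norm_num [affinityBound]

/-- The words of length `2 j` whose Bernoulli mass is exponentially larger than the length of the
corresponding interval. -/
def heavyWords (p : ℕ+ → ℝ) (j : ℕ) : Set (Fin (2 * j) → ℕ+) :=
  {w | cylLength (2 * j) w ≤ affinityBound ^ j * cylMass p (2 * j) w}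

lemma cylMass_le_of_notMem_heavyWords {p : ℕ+ → ℝ} (hp : IsProbVec p) {j : ℕ}
    {w : Fin (2 * j) → ℕ+} (hw : w ∉ heavyWords p j) :
    cylMass p (2 * j) w ≤
      (√affinityBound)⁻¹ ^ j * √(cylMass p (2 * j) w * cylLength (2 * j) w) := by
  have hw' : affinityBound ^ j * cylMass p (2 * j) w < cylLength (2 * j) w := not_le.1 hw
  have hM := cylMass_nonneg hp (2 * j) w
  have hρ : 0 < √affinityBound := Real.sqrt_pos.2 affinityBound_mem_Ioo.1
  rw [inv_pow, ← div_eq_inv_mul, le_div_iff₀ (by positivity)]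
  apply Real.le_sqrt_of_sq_le
  rw [mul_pow, ← pow_mul, mul_comm j 2, pow_mul, Real.sq_sqrt affinityBound_mem_Ioo.1.le]
  nlinarith

lemma measure_notMem_heavyWords_le {p : ℕ+ → ℝ} (hp : IsProbVec p) {m : Measure (ℕ → ℕ+)}
    (hm : IsBernoulli p m) (j : ℕ) :
    m {a | initialWord (2 * j) a ∉ heavyWords p j} ≤ ENNReal.ofReal √affinityBound ^ j := by
  have hρ : 0 < √affinityBound := Real.sqrt_pos.2 affinityBound_mem_Ioo.1
  have hcover : {a : ℕ → ℕ+ | initialWord (2 * j) a ∉ heavyWords p j} ⊆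
      ⋃ w : ↥(heavyWords p j)ᶜ, {a | initialWord (2 * j) a = w} := fun a ha =>
    mem_iUnion.2 ⟨⟨_, ha⟩, rfl⟩
  calc m {a | initialWord (2 * j) a ∉ heavyWords p j}
    _ ≤ ∑' w : ↥(heavyWords p j)ᶜ, m {a | initialWord (2 * j) a = w} :=
      (measure_mono hcover).trans (measure_iUnion_le _)
    _ ≤ ∑' w : ↥(heavyWords p j)ᶜ, ENNReal.ofReal (√affinityBound)⁻¹ ^ j *
          ENNReal.ofReal √(cylMass p (2 * j) w * cylLength (2 * j) w) := by
      refine ENNReal.tsum_le_tsum fun w => ?_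
      rw [hm.measure_initialWord, ← ENNReal.ofReal_pow (by positivity),
        ← ENNReal.ofReal_mul (by positivity)]
      exact ENNReal.ofReal_le_ofReal (cylMass_le_of_notMem_heavyWords hp w.2)
    _ ≤ ENNReal.ofReal (√affinityBound)⁻¹ ^ j * ENNReal.ofReal affinityBound ^ j := by
      rw [ENNReal.tsum_mul_left]
      gcongr
      exact (ENNReal.tsum_comp_le_tsum_of_injective Subtype.val_injective _).trans
        (tsum_sqrt_cylMass_mul_cylLength_le hp j)
    _ = ENNReal.ofReal √affinityBound ^ j := by
      rw [← mul_pow, ← ENNReal.ofReal_mul (by positivity)]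
      congr 2
      rw [← div_eq_inv_mul, Real.div_sqrt]

lemma ae_eventually_mem_heavyWords {p : ℕ+ → ℝ} (hp : IsProbVec p) {m : Measure (ℕ → ℕ+)}
    (hm : IsBernoulli p m) :
    ∀ᵐ a ∂m, ∀ᶠ j in atTop, initialWord (2 * j) a ∈ heavyWords p j := by
  have hlt : ENNReal.ofReal √affinityBound < 1 := by
    rw [ENNReal.ofReal_lt_one, Real.sqrt_lt' one_pos, one_pow]
    exact affinityBound_mem_Ioo.2
  have hsum : ∑' j, m {a | initialWord (2 * j) a ∉ heavyWords p j} ≠ ∞ := by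
    refine ne_top_of_le_ne_top ?_
      (ENNReal.tsum_le_tsum fun j => measure_notMem_heavyWords_le hp hm j)
    rw [ENNReal.tsum_geometric]
    exact ENNReal.inv_ne_top.2 (tsub_pos_of_lt hlt).ne'
  filter_upwards [ae_eventually_notMem hsum] with a ha
  simpa using ha

lemma tsum_cylLength_heavyWords_le {p : ℕ+ → ℝ} (hp : IsProbVec p) (j : ℕ) :
    ∑' w : heavyWords p j, ENNReal.ofReal (cylLength (2 * j) w)
      ≤ ENNReal.ofReal affinityBound ^ j := by
  have hρ := affinityBound_mem_Ioo.1
  calc ∑' w : heavyWords p j, ENNReal.ofReal (cylLength (2 * j) w)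
    _ ≤ ∑' w : heavyWords p j,
        ENNReal.ofReal affinityBound ^ j * ENNReal.ofReal (cylMass p (2 * j) w) := by
      refine ENNReal.tsum_le_tsum fun w => ?_
      rw [← ENNReal.ofReal_pow hρ.le, ← ENNReal.ofReal_mul (by positivity)]
      exact ENNReal.ofReal_le_ofReal w.2
    _ ≤ ENNReal.ofReal affinityBound ^ j * 1 := by
      rw [ENNReal.tsum_mul_left]
      gcongr
      exact (ENNReal.tsum_comp_le_tsum_of_injective Subtype.val_injective _).trans
        (tsum_cylMass hp _).le
    _ = _ := mul_one _

lemma tsum_rpow_mul_rpow_le {ι : Type*} (f g : ι → ℝ≥0∞) {s t : ℝ} (hs : 0 ≤ s) (ht : 0 ≤ t)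
    (hst : s + t = 1) : ∑' i, f i ^ s * g i ^ t ≤ (∑' i, f i) ^ s * (∑' i, g i) ^ t := by
  let _ : MeasurableSpace ι := ⊤
  have hf : Measurable f := measurable_from_top
  have hg : Measurable g := measurable_from_top
  simpa only [lintegral_count] using ENNReal.lintegral_mul_norm_pow_le (μ := Measure.count)
    hf.aemeasurable hg.aemeasurable hs ht hst

/-- The exponential growth rate of the sums of `cylLength w ^ (1 - θ / 4)` over heavy words. -/
noncomputable def heavyRate (θ : ℝ) : ℝ≥0∞ :=
  ENNReal.ofReal affinityBound ^ (1 - θ) * (digitProbPowBound ^ 2) ^ θ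

lemma exists_heavyRate_lt_one : ∃ θ ∈ Ioo (0 : ℝ) 1, heavyRate θ < 1 := by
  set B : ℝ := (digitProbPowBound ^ 2).toReal + 1 with hB
  have hB0 : 0 < B := by positivity
  have hMB : digitProbPowBound ^ 2 ≤ ENNReal.ofReal B := by
    rw [← ENNReal.ofReal_toReal (ENNReal.pow_ne_top digitProbPowBound_ne_top)]
    exact ENNReal.ofReal_le_ofReal (by linarith)
  obtain ⟨hρ0, hρ1⟩ := affinityBound_mem_Ioo
  have hcont : Continuous fun θ : ℝ => affinityBound ^ (1 - θ) * B ^ θ :=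
    ((Real.continuous_const_rpow hρ0.ne').comp (continuous_const.sub continuous_id)).mul
      (Real.continuous_const_rpow hB0.ne')
  have hev : ∀ᶠ θ in nhds (0 : ℝ), affinityBound ^ (1 - θ) * B ^ θ < 1 :=
    hcont.continuousAt.eventually_lt continuousAt_const (by simpa using hρ1)
  obtain ⟨θ, hθ, hθ01⟩ := ((hev.filter_mono nhdsWithin_le_nhds).and
    (Ioo_mem_nhdsGT (zero_lt_one' ℝ))).exists
  refine ⟨θ, hθ01, ?_⟩
  calc heavyRate θ ≤ ENNReal.ofReal affinityBound ^ (1 - θ) * ENNReal.ofReal B ^ θ := by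
        have := hθ01.1.le
        unfold heavyRate
        gcongr
    _ = ENNReal.ofReal (affinityBound ^ (1 - θ) * B ^ θ) := by
        rw [ENNReal.ofReal_rpow_of_pos hρ0, ENNReal.ofReal_rpow_of_pos hB0,
          ENNReal.ofReal_mul (by positivity)]
    _ < 1 := ENNReal.ofReal_lt_one.2 hθ

lemma tsum_cylLength_rpow_heavyWords_le {p : ℕ+ → ℝ} (hp : IsProbVec p) {θ : ℝ}
    (hθ : θ ∈ Ioo (0 : ℝ) 1) (j : ℕ) :
    ∑' w : heavyWords p j, ENNReal.ofReal (cylLength (2 * j) w) ^ (1 - θ / 4)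
      ≤ heavyRate θ ^ j := by
  obtain ⟨h0, h1⟩ := hθ
  have hsplit : ∀ w : heavyWords p j, ENNReal.ofReal (cylLength (2 * j) w) ^ (1 - θ / 4) =
      ENNReal.ofReal (cylLength (2 * j) w) ^ (1 - θ) *
        (ENNReal.ofReal (cylLength (2 * j) w) ^ (3 / 4 : ℝ)) ^ θ := by
    intro w
    rw [← ENNReal.rpow_mul, ← ENNReal.rpow_add_of_nonneg _ _ (by linarith) (by positivity)]
    congr 1
    ring
  simp_rw [hsplit]
  refine (tsum_rpow_mul_rpow_le _ _ (by linarith) h0.le (by ring)).trans ?_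
  calc _ ≤ (ENNReal.ofReal affinityBound ^ j) ^ (1 - θ) * (digitProbPowBound ^ (2 * j)) ^ θ := by
        gcongr
        · exact tsum_cylLength_heavyWords_le hp j
        · exact (ENNReal.tsum_comp_le_tsum_of_injective Subtype.val_injective _).trans
            (tsum_cylLength_rpow_le _)
    _ = heavyRate θ ^ j := by
        rw [heavyRate, mul_pow, pow_mul]
        simp only [← ENNReal.rpow_natCast, ← ENNReal.rpow_mul, mul_comm, mul_left_comm]

lemma ediam_cfVal_image_le (n : ℕ) (w : Fin n → ℕ+) :
    Metric.ediam (cfVal '' {a | initialWord n a = w}) ≤ 2 * ENNReal.ofReal (cylLength n w) := by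
  rw [← ENNReal.ofReal_ofNat, ← ENNReal.ofReal_mul zero_le_two]
  apply Metric.ediam_le_of_forall_dist_le
  rintro _ ⟨a, rfl, rfl⟩ _ ⟨b, hb, rfl⟩
  exact dist_cfVal_le hb.symm

lemma dimH_cfVal_image_le {p : ℕ+ → ℝ} (hp : IsProbVec p) {θ : ℝ} (hθ : θ ∈ Ioo (0 : ℝ) 1)
    (hrate : heavyRate θ < 1) {S : Set (ℕ → ℕ+)}
    (hS : ∀ᶠ j in atTop, ∀ a ∈ S, initialWord (2 * j) a ∈ heavyWords p j) :
    dimH (cfVal '' S) ≤ ENNReal.ofReal (1 - θ / 4) := by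
  have hs : 0 ≤ 1 - θ / 4 := by linarith [hθ.2]
  have hcover := Measure.hausdorffMeasure_le_liminf_tsum (1 - θ / 4) (cfVal '' S) (l := atTop)
    (fun j : ℕ => 2 * ENNReal.ofReal ((1 / 2) ^ (2 * j)))
    (by
      have h : Tendsto (fun j : ℕ => ((1 / 2 : ℝ)) ^ (2 * j)) atTop (nhds 0) := by
        simp_rw [pow_mul]
        exact tendsto_pow_atTop_nhds_zero_of_lt_one (by norm_num) (by norm_num)
      simpa using ENNReal.Tendsto.const_mul (ENNReal.tendsto_ofReal h)
        (Or.inr ENNReal.ofNat_ne_top) (a := 2))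
    (fun j (w : heavyWords p j) => cfVal '' {a | initialWord (2 * j) a = w})
    (Eventually.of_forall fun j w => (ediam_cfVal_image_le _ _).trans (by
      gcongr
      exact cylLength_le _ _))
    (hS.mono fun j hj => by
      rintro _ ⟨a, ha, rfl⟩
      exact mem_iUnion.2 ⟨⟨_, hj a ha⟩, a, rfl, rfl⟩)
  have hbound : ∀ j : ℕ, ∑' w : heavyWords p j,
      Metric.ediam (cfVal '' {a | initialWord (2 * j) a = w}) ^ (1 - θ / 4)
        ≤ 2 ^ (1 - θ / 4) * heavyRate θ ^ j := by
    intro j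
    calc _ ≤ ∑' w : heavyWords p j,
          2 ^ (1 - θ / 4) * ENNReal.ofReal (cylLength (2 * j) w) ^ (1 - θ / 4) := by
          refine ENNReal.tsum_le_tsum fun w => ?_
          rw [← ENNReal.mul_rpow_of_nonneg _ _ hs]
          exact ENNReal.rpow_le_rpow (ediam_cfVal_image_le _ _) hs
      _ ≤ _ := by
          rw [ENNReal.tsum_mul_left]
          gcongr
          exact tsum_cylLength_rpow_heavyWords_le hp hθ j
  have hlim : Tendsto (fun j : ℕ => (2 : ℝ≥0∞) ^ (1 - θ / 4) * heavyRate θ ^ j) atTop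
      (nhds 0) := by
    simpa using ENNReal.Tendsto.const_mul (ENNReal.tendsto_pow_atTop_nhds_zero_of_lt_one hrate)
      (Or.inr (ENNReal.rpow_ne_top_of_nonneg hs ENNReal.ofNat_ne_top))
  have hzero : μH[1 - θ / 4] (cfVal '' S) = 0 :=
    le_antisymm (hcover.trans ((liminf_le_liminf (Eventually.of_forall hbound)).trans
      hlim.liminf_eq.le)) zero_le
  apply dimH_le_of_hausdorffMeasure_ne_top (d := (1 - θ / 4).toNNReal)
  rw [Real.coe_toNNReal _ hs, hzero]
  exact ENNReal.zero_ne_top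

theorem dimMeasure_map_cfVal_le {p : ℕ+ → ℝ} (hp : IsProbVec p) {m : Measure (ℕ → ℕ+)}
    [IsProbabilityMeasure m] (hm : IsBernoulli p m) {θ : ℝ} (hθ : θ ∈ Ioo (0 : ℝ) 1)
    (hrate : heavyRate θ < 1) : dimMeasure (m.map cfVal) ≤ ENNReal.ofReal (1 - θ / 4) := by
  let S : ℕ → Set (ℕ → ℕ+) :=
    fun N => {a | ∀ j ≥ N, initialWord (2 * j) a ∈ heavyWords p j}
  have hmap : IsProbabilityMeasure (m.map cfVal) :=
    Measure.isProbabilityMeasure_map measurable_cfVal.aemeasurable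
  have hfull : m (⋃ N, S N) = 1 := by
    rw [← measure_univ (μ := m)]
    refine measure_congr (eventuallyEq_univ.2 ?_)
    filter_upwards [ae_eventually_mem_heavyWords hp hm] with a ha
    exact mem_iUnion.2 (eventually_atTop.1 ha)
  have hone : m.map cfVal (cfVal '' ⋃ N, S N) = 1 := by
    refine le_antisymm prob_le_one ?_
    rw [← hfull]
    exact Measure.le_map_apply_image measurable_cfVal.aemeasurable _
  have hle : dimMeasure (m.map cfVal) ≤ dimH (cfVal '' ⋃ N, S N) :=
    iInf_le_of_le _ (iInf_le _ hone)
  refine hle.trans ?_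
  rw [image_iUnion, dimH_iUnion]
  exact iSup_le fun N => dimH_cfVal_image_le hp hθ hrate
    ((eventually_ge_atTop N).mono fun j hj a ha => ha j hj)

/-- **Uniform dimension bound for measures satisfying Hypothesis 2** (Lemma 4.1):
for every `ε ∈ (0, ψ)` there is `η₁ > 0` such that every probability vector `p` with
strictly positive decreasing entries satisfying `p_n = O(1/n²)`, `dim μ_p > 3/4`, and
either (`p₁ ≥ ε` and `p₂ ≥ ε`) or `p₁ > ψ`, satisfies `dim μ_p ≤ 1 - η₁`. -/
theorem dim_bound_of_hyp (ε : ℝ) (hε : ε ∈ Set.Ioo (0 : ℝ) psi) :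
    ∃ η1 : ℝ≥0∞, 0 < η1 ∧
      ∀ (p : ℕ+ → ℝ) (m : Measure (ℕ → ℕ+)),
        IsProbVec p → IsProbabilityMeasure m → IsBernoulli p m →
        (∀ n, 0 < p n) → Antitone p →
        (∃ K : ℝ, 0 < K ∧ ∀ n : ℕ+, p n ≤ K / ((n : ℕ) : ℝ) ^ 2) →
        (3 / 4 : ℝ≥0∞) < dimMeasure (m.map cfVal) →
        ((ε ≤ p 1 ∧ ε ≤ p 2) ∨ psi < p 1) →
          dimMeasure (m.map cfVal) ≤ 1 - η1 := by
  obtain ⟨θ, hθ, hrate⟩ := exists_heavyRate_lt_one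
  refine ⟨1 - ENNReal.ofReal (1 - θ / 4), tsub_pos_of_lt ?_, ?_⟩
  · exact ENNReal.ofReal_lt_one.2 (by linarith [hθ.1])
  intro p m hp _ hm _ _ _ _ _
  rw [ENNReal.sub_sub_cancel ENNReal.one_ne_top
    (ENNReal.ofReal_le_one.2 (by linarith [hθ.1]))]
  exact dimMeasure_map_cfVal_le hp hm hθ hrate
end

section
/- Sharpness of the interval-length decay condition: let T be a countable full-branch expanding map as described, satisfying (1) some iterate is uniformly expanding (there exist l ∈ ℕ and Λ > 1 with |(T^l)′(x)| ≥ Λ for all x) and (2) the Rényi condition sup_n sup_{x,y,z∈I_n} |T″(x)|/(|T′(y)|·|T′(z)|) < ∞. If for every s < 1 one has Σ_n |I_n|^s = ∞, then there is no dimension gap: sup_p dim μ_p = 1, where the supremum is over all probability vectors p. In fact, for every t ∈ (0,1) there exist finitely supported probability vectors p with dim μ_p arbitrarily close to or exceeding t. -/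
open MeasureTheory Filter Set
open scoped ENNReal

/-- Approximants for the coding map of a countable full-branch system with inverse
branches `g n`: `codeApprox g k s = g_{s 0} (g_{s 1} (⋯ (g_{s (k-1)} 0)))`. -/
noncomputable def codeApprox (g : ℕ+ → ℝ → ℝ) : ℕ → (ℕ → ℕ+) → ℝ
  | 0, _ => 0
  | k + 1, s => g (s 0) (codeApprox g k (fun j => s (j + 1)))

/-- The coding map `Π(i) = lim_n T_{i_1}⁻¹ ∘ ⋯ ∘ T_{i_n}⁻¹ ([0,1])`. -/
noncomputable def codeVal (g : ℕ+ → ℝ → ℝ) (s : ℕ → ℕ+) : ℝ :=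
  limUnder atTop (fun k => codeApprox g k s)

open scoped Topology

instance : DiscreteMeasurableSpace ℕ+ := ⟨fun _ => trivial⟩

/-- Prepend a symbol to a sequence. -/
def consSeq (i : ℕ+) (s : ℕ → ℕ+) : ℕ → ℕ+
  | 0 => i
  | k + 1 => s k

/-- A C² map of `[a, b]` into `[0, 1]` satisfying the Rényi condition is Lipschitz with constant
comparable to the inverse of the length of `[a, b]`. -/
theorem abs_sub_le_of_renyi {f : ℝ → ℝ} {a b κ : ℝ} (hab : a < b) (hf : ContDiff ℝ 2 f)
    (hmaps : MapsTo f (Icc a b) (Icc 0 1))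
    (hκ : ∀ x ∈ Icc a b, ∀ y ∈ Icc a b, ∀ z ∈ Icc a b,
      |deriv (deriv f) x| ≤ κ * (|deriv f y| * |deriv f z|)) :
    ∀ u ∈ Icc a b, ∀ v ∈ Icc a b, |f u - f v| ≤ (1 + |κ|) / (b - a) * |u - v| := by
  have hba : 0 < b - a := sub_pos.2 hab
  have hf1 : Differentiable ℝ f := hf.differentiable (by norm_num)
  have hf2 : Differentiable ℝ (deriv f) := by
    have h : ContDiff ℝ (1 + 1) f := by simpa [one_add_one_eq_two] using hf
    exact (contDiff_succ_iff_deriv.1 h).2.2.differentiable (by norm_num)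
  obtain ⟨c, hc, hcd⟩ := exists_deriv_eq_slope f hab hf1.continuous.continuousOn
    hf1.differentiableOn
  have hc' : c ∈ Icc a b := Ioo_subset_Icc_self hc
  have hslope : |deriv f c| ≤ 1 / (b - a) := by
    rw [hcd, abs_div, abs_of_pos hba]
    have h1 := hmaps (left_mem_Icc.2 hab.le)
    have h2 := hmaps (right_mem_Icc.2 hab.le)
    gcongr
    rw [abs_le]
    constructor <;> linarith [h1.1, h1.2, h2.1, h2.2]
  have hbound2 : ∀ x ∈ Icc a b, ‖deriv (deriv f) x‖ ≤ |κ| * (1 / (b - a)) ^ 2 := fun x hx => by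
    refine (hκ x hx c hc' c hc').trans ?_
    have : |deriv f c| * |deriv f c| ≤ (1 / (b - a)) ^ 2 := by
      rw [sq]; gcongr
    exact mul_le_mul (le_abs_self κ) this (by positivity) (abs_nonneg κ)
  have hbound1 : ∀ x ∈ Icc a b, ‖deriv f x‖ ≤ (1 + |κ|) / (b - a) := fun x hx => by
    have h := (convex_Icc a b).norm_image_sub_le_of_norm_deriv_le (fun y _ => hf2 y) hbound2 hc' hx
    have hxc : ‖x - c‖ ≤ b - a := by
      rw [Real.norm_eq_abs, abs_le]
      constructor <;> linarith [hx.1, hx.2, hc'.1, hc'.2]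
    have h3 : |κ| * (1 / (b - a)) ^ 2 * ‖x - c‖ ≤ |κ| / (b - a) := by
      calc |κ| * (1 / (b - a)) ^ 2 * ‖x - c‖ ≤ |κ| * (1 / (b - a)) ^ 2 * (b - a) := by gcongr
        _ = |κ| / (b - a) := by field_simp
    calc ‖deriv f x‖ ≤ ‖deriv f c‖ + ‖deriv f x - deriv f c‖ := norm_le_norm_add_norm_sub' _ _
      _ ≤ 1 / (b - a) + |κ| / (b - a) := add_le_add hslope (h.trans h3)
      _ = (1 + |κ|) / (b - a) := by ring
  intro u hu v hv
  exact (convex_Icc a b).norm_image_sub_le_of_norm_deriv_le (fun y _ => hf1 y) hbound1 hv hu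

/-- A C¹ map with derivative larger than one in absolute value expands uniformly on `[a, b]`. -/
theorem exists_abs_sub_le_of_one_lt_abs_deriv {f : ℝ → ℝ} {a b : ℝ} (hab : a < b)
    (hf : ContDiff ℝ 1 f) (hexp : ∀ x ∈ Icc a b, 1 < |deriv f x|) :
    ∃ θ : ℝ, 0 ≤ θ ∧ θ < 1 ∧ ∀ u ∈ Icc a b, ∀ v ∈ Icc a b, |u - v| ≤ θ * |f u - f v| := by
  have hf1 : Differentiable ℝ f := hf.differentiable (by norm_num)
  have hcont : Continuous fun x => |deriv f x| := (hf.continuous_deriv le_rfl).abs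
  obtain ⟨z, hz, hmin⟩ := isCompact_Icc.exists_isMinOn (nonempty_Icc.2 hab.le) hcont.continuousOn
  have hz1 := hexp z hz
  refine ⟨|deriv f z|⁻¹, by positivity, inv_lt_one_of_one_lt₀ hz1, ?_⟩
  have key : ∀ u ∈ Icc a b, ∀ v ∈ Icc a b, u < v → |u - v| ≤ |deriv f z|⁻¹ * |f u - f v| := by
    intro u hu v hv huv
    obtain ⟨c, hc, hcd⟩ := exists_deriv_eq_slope f huv hf1.continuous.continuousOn
      hf1.differentiableOn
    have hcI : c ∈ Icc a b := ⟨hu.1.trans hc.1.le, hc.2.le.trans hv.2⟩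
    have h : |deriv f z| ≤ |deriv f c| := hmin hcI
    have hvu : 0 < |v - u| := abs_pos.2 (sub_pos.2 huv).ne'
    rw [hcd, abs_div, le_div_iff₀ hvu] at h
    rw [abs_sub_comm u v, abs_sub_comm (f u), le_inv_mul_iff₀ (by linarith)]
    exact h
  intro u hu v hv
  rcases lt_trichotomy u v with h | h | h
  · exact key u hu v hv h
  · simp [h]
  · rw [abs_sub_comm u v, abs_sub_comm (f u)]
    exact key v hv u hu h

section Coding

variable {g : ℕ+ → ℝ → ℝ}

theorem codeApprox_mem_Icc (hg : ∀ n, MapsTo (g n) (Icc 0 1) (Icc 0 1)) (k : ℕ) (s : ℕ → ℕ+) :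
    codeApprox g k s ∈ Icc (0 : ℝ) 1 := by
  induction k generalizing s with
  | zero => simp [codeApprox]
  | succ k ih => exact hg _ (ih _)

theorem tendsto_codeApprox (hg : ∀ n, MapsTo (g n) (Icc 0 1) (Icc 0 1)) {F : Finset ℕ+} {θ : ℝ}
    (hθ0 : 0 ≤ θ) (hθ1 : θ < 1)
    (hcontr : ∀ i ∈ F, ∀ x ∈ Icc (0 : ℝ) 1, ∀ y ∈ Icc (0 : ℝ) 1, |g i x - g i y| ≤ θ * |x - y|)
    {s : ℕ → ℕ+} (hs : ∀ k, s k ∈ F) :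
    Tendsto (fun k => codeApprox g k s) atTop (𝓝 (codeVal g s)) := by
  have hgeom : ∀ k, ∀ s : ℕ → ℕ+, (∀ k, s k ∈ F) →
      |codeApprox g k s - codeApprox g (k + 1) s| ≤ 1 * θ ^ k := by
    intro k
    induction k with
    | zero =>
      intro s _
      have h0 := codeApprox_mem_Icc hg 0 s
      have h1 := codeApprox_mem_Icc hg 1 s
      rw [pow_zero, mul_one, zero_add, abs_le]
      constructor <;> linarith [h0.1, h0.2, h1.1, h1.2]
    | succ k ih =>
      intro s hs
      calc |codeApprox g (k + 1) s - codeApprox g (k + 1 + 1) s|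
          ≤ θ * |codeApprox g k (fun j => s (j + 1)) - codeApprox g (k + 1) (fun j => s (j + 1))| :=
            hcontr _ (hs 0) _ (codeApprox_mem_Icc hg _ _) _ (codeApprox_mem_Icc hg _ _)
        _ ≤ θ * (1 * θ ^ k) := by gcongr; exact ih _ fun j => hs (j + 1)
        _ = 1 * θ ^ (k + 1) := by ring
  have hcauchy : CauchySeq fun k => codeApprox g k s :=
    cauchySeq_of_le_geometric θ 1 hθ1 fun k => hgeom k s hs
  exact tendsto_nhds_limUnder (cauchySeq_tendsto_of_complete hcauchy)

theorem codeVal_mem_Icc (hg : ∀ n, MapsTo (g n) (Icc 0 1) (Icc 0 1)) {s : ℕ → ℕ+}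
    (hs : Tendsto (fun k => codeApprox g k s) atTop (𝓝 (codeVal g s))) :
    codeVal g s ∈ Icc (0 : ℝ) 1 :=
  isClosed_Icc.mem_of_tendsto hs (Eventually.of_forall fun k => codeApprox_mem_Icc hg k s)

theorem codeVal_consSeq (hg : ∀ n, MapsTo (g n) (Icc 0 1) (Icc 0 1)) {i : ℕ+}
    (hcont : ContinuousOn (g i) (Icc 0 1)) {s : ℕ → ℕ+}
    (hs : Tendsto (fun k => codeApprox g k s) atTop (𝓝 (codeVal g s))) :
    codeVal g (consSeq i s) = g i (codeVal g s) := by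
  have h1 : Tendsto (fun k => codeApprox g (k + 1) (consSeq i s)) atTop (𝓝 (g i (codeVal g s))) :=
    (hcont _ (codeVal_mem_Icc hg hs)).tendsto.comp
      (tendsto_nhdsWithin_iff.2 ⟨hs, Eventually.of_forall fun k => codeApprox_mem_Icc hg k s⟩)
  exact ((tendsto_add_atTop_iff_nat 1).1 h1).limUnder_eq

theorem measurable_comp_codeApprox (g : ℕ+ → ℝ → ℝ) (k : ℕ) (f : ℝ → ℝ) :
    Measurable fun s => f (codeApprox g k s) := by
  induction k generalizing f with
  | zero => simp only [codeApprox, measurable_const]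
  | succ k ih =>
    have h : Measurable fun q : ℕ+ × (ℕ → ℕ+) => f (g q.1 (codeApprox g k q.2)) :=
      measurable_from_prod_countable_right fun i => ih fun x => f (g i x)
    have h2 : Measurable fun s : ℕ → ℕ+ => (s 0, fun j => s (j + 1)) :=
      (measurable_pi_apply 0).prodMk (measurable_pi_lambda _ fun j => measurable_pi_apply (j + 1))
    exact h.comp h2

theorem measurable_codeVal (g : ℕ+ → ℝ → ℝ) : Measurable (codeVal g) :=
  (StronglyMeasurable.limUnder (l := atTop) fun k =>
    (measurable_comp_codeApprox g k id).stronglyMeasurable).measurable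

end Coding

theorem measurable_consSeq : Measurable fun q : ℕ+ × (ℕ → ℕ+) => consSeq q.1 q.2 := by
  refine measurable_pi_lambda _ fun k => ?_
  cases k with
  | zero => exact measurable_fst
  | succ k => exact (measurable_pi_apply k).comp measurable_snd

theorem map_consSeq_prod_infinitePi (P : Measure ℕ+) [IsProbabilityMeasure P] :
    (P.prod (Measure.infinitePi fun _ : ℕ => P)).map (fun q => consSeq q.1 q.2) =
      Measure.infinitePi fun _ : ℕ => P := by
  classical
  refine Measure.eq_infinitePi _ fun S t ht => ?_
  obtain ⟨N, hN⟩ := S.exists_nat_subset_range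
  set t' : ℕ → Set ℕ+ := fun k => if k ∈ S then t k else univ with ht'
  have hpre : (fun q : ℕ+ × (ℕ → ℕ+) => consSeq q.1 q.2) ⁻¹' (S : Set ℕ).pi t =
      t' 0 ×ˢ (Finset.range N : Set ℕ).pi fun k => t' (k + 1) := by
    ext ⟨i, s⟩
    simp only [mem_preimage, Set.mem_pi, Finset.mem_coe, mem_prod, Finset.mem_range, ht']
    constructor
    · intro h
      refine ⟨?_, fun k _ => ?_⟩
      · split_ifs with h0
        exacts [h 0 h0, trivial]
      · split_ifs with h0
        exacts [h (k + 1) h0, trivial]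
    · rintro ⟨h0, h1⟩ k hk
      cases k with
      | zero => simpa [hk, consSeq] using h0
      | succ k =>
        have hkN : k + 1 < N := Finset.mem_range.1 (hN hk)
        simpa [hk, consSeq] using h1 k (by omega)
  rw [Measure.map_apply measurable_consSeq
      (MeasurableSet.pi (Finset.countable_toSet S) fun k _ => ht k), hpre, Measure.prod_prod,
    Measure.infinitePi_pi _ fun _ _ => .of_discrete, mul_comm,
    ← Finset.prod_range_succ' (fun k => P (t' k)) N]
  have hsub : S ⊆ Finset.range (N + 1) := hN.trans (Finset.range_mono N.le_succ)
  rw [← Finset.prod_subset hsub fun k _ hk => by simp [ht', hk]]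
  exact Finset.prod_congr rfl fun k hk => by simp [ht', hk]

/-- The measure on symbols with finitely many atoms `i ∈ F` of mass `p i`. -/
noncomputable def symbolMeasure (F : Finset ℕ+) (p : ℕ+ → ℝ) : Measure ℕ+ :=
  ∑ i ∈ F, ENNReal.ofReal (p i) • Measure.dirac i

section SymbolMeasure

variable {F : Finset ℕ+} {p : ℕ+ → ℝ}

theorem symbolMeasure_singleton (hF : ∀ i ∉ F, p i = 0) (i : ℕ+) :
    symbolMeasure F p {i} = ENNReal.ofReal (p i) := by
  classical
  simp only [symbolMeasure, Measure.coe_finsetSum, Finset.sum_apply, Measure.smul_apply,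
    Measure.dirac_apply, smul_eq_mul, indicator_apply, mem_singleton_iff, Pi.one_apply, mul_ite,
    mul_one, mul_zero, Finset.sum_ite_eq']
  split_ifs with h
  · rfl
  · simp [hF i h]

theorem isProbabilityMeasure_symbolMeasure (hp : ∀ i, 0 ≤ p i) (hsum : ∑ i ∈ F, p i = 1) :
    IsProbabilityMeasure (symbolMeasure F p) := by
  constructor
  simp [symbolMeasure, ← ENNReal.ofReal_sum_of_nonneg fun i _ => hp i, hsum]

theorem isBernoulli_infinitePi_symbolMeasure [IsProbabilityMeasure (symbolMeasure F p)]
    (hp : ∀ i, 0 ≤ p i) (hF : ∀ i ∉ F, p i = 0) :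
    IsBernoulli p (Measure.infinitePi fun _ : ℕ => symbolMeasure F p) := by
  intro n i
  have h : {s : ℕ → ℕ+ | ∀ k < n, s k = i k} =
      (Finset.range n : Set ℕ).pi fun k => {i k} := by
    ext s; simp
  rw [h, Measure.infinitePi_pi _ fun _ _ => .of_discrete,
    ENNReal.ofReal_prod_of_nonneg fun k _ => hp _]
  exact Finset.prod_congr rfl fun k _ => symbolMeasure_singleton hF _

theorem ae_forall_mem_infinitePi_symbolMeasure [IsProbabilityMeasure (symbolMeasure F p)] :
    ∀ᵐ s ∂(Measure.infinitePi fun _ : ℕ => symbolMeasure F p), ∀ k, s k ∈ F := by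
  refine ae_all_iff.2 fun k => ?_
  have h : ∀ᵐ i ∂(symbolMeasure F p), i ∈ F := by
    rw [ae_iff]
    simp only [symbolMeasure, Measure.coe_finsetSum, Finset.sum_apply, Measure.smul_apply,
      Measure.dirac_apply, smul_eq_mul]
    exact Finset.sum_eq_zero fun i hi => by simp [hi]
  exact (measurePreserving_eval_infinitePi (fun _ : ℕ => symbolMeasure F p)
    k).quasiMeasurePreserving.ae h

theorem infinitePi_symbolMeasure_apply [IsProbabilityMeasure (symbolMeasure F p)]
    {E : Set (ℕ → ℕ+)} (hE : MeasurableSet E) :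
    (Measure.infinitePi fun _ : ℕ => symbolMeasure F p) E =
      ∑ i ∈ F, ENNReal.ofReal (p i) *
        (Measure.infinitePi fun _ : ℕ => symbolMeasure F p) {s | consSeq i s ∈ E} := by
  conv_lhs => rw [← map_consSeq_prod_infinitePi (symbolMeasure F p)]
  rw [Measure.map_apply measurable_consSeq hE, Measure.prod_apply (measurable_consSeq hE)]
  conv_lhs => rw [symbolMeasure]
  rw [lintegral_finsetSum_measure]
  refine Finset.sum_congr rfl fun i _ => ?_
  rw [lintegral_smul_measure, lintegral_dirac, smul_eq_mul]
  rfl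

end SymbolMeasure

/-- A set of diameter `ℓ` meets at most two of a family of intervals with disjoint interiors and
lengths larger than `ℓ`. -/
theorem card_filter_inter_Icc_le_two {a b : ℕ+ → ℝ} (F : Finset ℕ+) (hab : ∀ n, a n < b n)
    (hdisj : ∀ n m : ℕ+, n ≠ m → Disjoint (Ioo (a n) (b n)) (Ioo (a m) (b m)))
    {S : Set ℝ} {ℓ : ℝ} (hS : ∀ x ∈ S, ∀ y ∈ S, |x - y| ≤ ℓ) (hℓ : ∀ i ∈ F, ℓ < b i - a i)
    [DecidablePred fun i => (S ∩ Icc (a i) (b i)).Nonempty] :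
    (F.filter fun i => (S ∩ Icc (a i) (b i)).Nonempty).card ≤ 2 := by
  by_contra! hcard
  obtain ⟨i, hi, j, hj, k, hk, hij, hik, hjk⟩ := Finset.two_lt_card.1 hcard
  have hord : ∀ n m, n ≠ m → b n ≤ a m ∨ b m ≤ a n := by
    intro n m hnm
    have h := Ioo_disjoint_Ioo.1 (hdisj n m hnm)
    rcases min_le_iff.1 h with h | h <;> rcases le_max_iff.1 h with h | h
    · linarith [hab n]
    · exact Or.inl h
    · exact Or.inr h
    · linarith [hab m]
  simp only [Finset.mem_filter] at hi hj hk
  obtain ⟨hiF, x, hxS, hx⟩ := hi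
  obtain ⟨hjF, y, hyS, hy⟩ := hj
  obtain ⟨hkF, z, hzS, hz⟩ := hk
  have hxy := abs_le.1 (hS x hxS y hyS)
  have hxz := abs_le.1 (hS x hxS z hzS)
  have hyz := abs_le.1 (hS y hyS z hzS)
  have := hℓ i hiF
  have := hℓ j hjF
  have := hℓ k hkF
  rw [mem_Icc] at hx hy hz
  rcases hord i j hij with h1 | h1 <;> rcases hord i k hik with h2 | h2 <;>
    rcases hord j k hjk with h3 | h3 <;> linarith [hab i, hab j, hab k]

/-- If `p i ≤ (r i) ^ t / 2`, where `r i` bounds from below the contraction of the inverse branch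
`g i`, then the image of the Bernoulli measure under the coding map is `t`-Frostman. -/
theorem exists_map_codeVal_le {a b : ℕ+ → ℝ} {g : ℕ+ → ℝ → ℝ} {F : Finset ℕ+} {p r : ℕ+ → ℝ}
    {t θ : ℝ} [IsProbabilityMeasure (symbolMeasure F p)] (hab : ∀ n, a n < b n)
    (hsub : ∀ n, 0 ≤ a n ∧ b n ≤ 1)
    (hdisj : ∀ n m : ℕ+, n ≠ m → Disjoint (Ioo (a n) (b n)) (Ioo (a m) (b m)))
    (hg : ∀ n, MapsTo (g n) (Icc 0 1) (Icc (a n) (b n))) (ht : 0 < t) (hθ0 : 0 ≤ θ) (hθ1 : θ < 1)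
    (hcontr : ∀ i ∈ F, ∀ x ∈ Icc (0 : ℝ) 1, ∀ y ∈ Icc (0 : ℝ) 1, |g i x - g i y| ≤ θ * |x - y|)
    (hr0 : ∀ i ∈ F, 0 < r i) (hr1 : ∀ i ∈ F, r i ≤ 1 / 2) (hrab : ∀ i ∈ F, r i ≤ b i - a i)
    (hexp : ∀ i ∈ F, ∀ x ∈ Icc (0 : ℝ) 1, ∀ y ∈ Icc (0 : ℝ) 1, r i * |x - y| ≤ |g i x - g i y|)
    (hp : ∀ i ∈ F, p i ≤ r i ^ t / 2) :
    ∃ M : ℝ, 0 < M ∧ ∀ ℓ : ℝ, 0 < ℓ → ∀ S : Set ℝ, (∀ x ∈ S, ∀ y ∈ S, |x - y| ≤ ℓ) →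
      (Measure.infinitePi fun _ : ℕ => symbolMeasure F p).map (codeVal g) S ≤
        ENNReal.ofReal (M * ℓ ^ t) := by
  classical
  set m := Measure.infinitePi fun _ : ℕ => symbolMeasure F p with hm
  have hgI : ∀ n, MapsTo (g n) (Icc 0 1) (Icc 0 1) := fun n =>
    (hg n).mono_right (Icc_subset_Icc (hsub n).1 (hsub n).2)
  have hcont : ∀ i ∈ F, ContinuousOn (g i) (Icc 0 1) := fun i hi =>
    (LipschitzOnWith.of_dist_le_mul (K := ⟨θ, hθ0⟩) fun x hx y hy =>
      hcontr i hi x hx y hy).continuousOn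
  have hconv : ∀ᵐ s ∂m, Tendsto (fun k => codeApprox g k s) atTop (𝓝 (codeVal g s)) := by
    filter_upwards [ae_forall_mem_infinitePi_symbolMeasure (F := F) (p := p)] with s hs
    exact tendsto_codeApprox hgI hθ0 hθ1 hcontr hs
  have hprob : IsProbabilityMeasure (m.map (codeVal g)) :=
    Measure.isProbabilityMeasure_map (measurable_codeVal g).aemeasurable
  obtain ⟨δ, hδ0, hδ⟩ : ∃ δ : ℝ, 0 < δ ∧ ∀ i ∈ F, δ ≤ r i := by
    rcases F.eq_empty_or_nonempty with rfl | hF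
    · exact ⟨1, one_pos, by simp⟩
    · obtain ⟨i, hi, hmin⟩ := F.exists_min_image r hF
      exact ⟨r i, hr0 i hi, hmin⟩
  refine ⟨(δ ^ t)⁻¹, by positivity, ?_⟩
  have hM : 0 ≤ (δ ^ t)⁻¹ := by positivity
  have hlarge : ∀ ℓ : ℝ, δ ≤ ℓ → ∀ S : Set ℝ,
      m.map (codeVal g) S ≤ ENNReal.ofReal ((δ ^ t)⁻¹ * ℓ ^ t) := fun ℓ hℓ S => by
    refine prob_le_one.trans (ENNReal.one_le_ofReal.2 ?_)
    rw [le_inv_mul_iff₀ (by positivity), mul_one]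
    exact Real.rpow_le_rpow hδ0.le hℓ ht.le
  have hind : ∀ n : ℕ, ∀ ℓ : ℝ, 0 < ℓ → δ * (1 / 2) ^ n ≤ ℓ → ∀ S : Set ℝ,
      (∀ x ∈ S, ∀ y ∈ S, |x - y| ≤ ℓ) →
      m.map (codeVal g) S ≤ ENNReal.ofReal ((δ ^ t)⁻¹ * ℓ ^ t) := by
    intro n
    induction n with
    | zero => exact fun ℓ _ hℓ S _ => hlarge ℓ (by simpa using hℓ) S
    | succ n ih =>
      intro ℓ hℓ0 hℓ S₀ hS₀
      rcases le_or_gt δ ℓ with hδℓ | hℓδ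
      · exact hlarge ℓ hδℓ S₀
      set S := closure S₀ with hSdef
      have hS : ∀ x ∈ S, ∀ y ∈ S, |x - y| ≤ ℓ := fun x hx y hy =>
        isClosed_Iic.closure_subset_iff.2 (Subset.refl (Iic ℓ))
          (map_mem_closure₂ (f := fun x y : ℝ => |x - y|) (by fun_prop) hx hy hS₀)
      have hSm : MeasurableSet S := isClosed_closure.measurableSet
      refine (measure_mono subset_closure).trans ?_
      rw [← hSdef, Measure.map_apply (measurable_codeVal g) hSm,
        infinitePi_symbolMeasure_apply (measurable_codeVal g hSm), ← hm]
      have hterm : ∀ i ∈ F, m {s | consSeq i s ∈ codeVal g ⁻¹' S} ≤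
          m.map (codeVal g) {x | x ∈ Icc (0 : ℝ) 1 ∧ g i x ∈ S} := fun i hi => by
        refine le_trans (measure_mono_ae ?_)
          (Measure.le_map_apply (measurable_codeVal g).aemeasurable _)
        filter_upwards [hconv] with s hs hsS
        refine ⟨codeVal_mem_Icc hgI hs, ?_⟩
        rw [← codeVal_consSeq hgI (hcont i hi) hs]
        exact hsS
      have hzero : ∀ i ∈ F, ¬ (S ∩ Icc (a i) (b i)).Nonempty →
          m {s | consSeq i s ∈ codeVal g ⁻¹' S} = 0 := fun i hi hne => by
        refine le_antisymm ((hterm i hi).trans (le_of_eq ?_)) zero_le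
        convert measure_empty (μ := m.map (codeVal g))
        exact eq_empty_of_forall_notMem fun x hx => hne ⟨g i x, hx.2, hg i hx.1⟩
      have hmain : ∀ i ∈ F, ENNReal.ofReal (p i) * m {s | consSeq i s ∈ codeVal g ⁻¹' S} ≤
          ENNReal.ofReal ((δ ^ t)⁻¹ * ℓ ^ t / 2) := fun i hi => by
        have hri := hr0 i hi
        have h1 : m.map (codeVal g) {x | x ∈ Icc (0 : ℝ) 1 ∧ g i x ∈ S} ≤
            ENNReal.ofReal ((δ ^ t)⁻¹ * (ℓ / r i) ^ t) := by
          refine ih (ℓ / r i) (by positivity) ?_ _ fun x hx y hy => ?_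
          · rw [le_div_iff₀ hri]
            calc δ * (1 / 2) ^ n * r i ≤ δ * (1 / 2) ^ n * (1 / 2) := by
                  gcongr; exact hr1 i hi
              _ = δ * (1 / 2) ^ (n + 1) := by ring
              _ ≤ ℓ := hℓ
          · rw [le_div_iff₀ hri, mul_comm]
            exact (hexp i hi x hx.1 y hy.1).trans (hS _ hx.2 _ hy.2)
        calc ENNReal.ofReal (p i) * m {s | consSeq i s ∈ codeVal g ⁻¹' S}
            ≤ ENNReal.ofReal (r i ^ t / 2) * ENNReal.ofReal ((δ ^ t)⁻¹ * (ℓ / r i) ^ t) :=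
              mul_le_mul' (ENNReal.ofReal_le_ofReal (hp i hi)) ((hterm i hi).trans h1)
          _ = ENNReal.ofReal ((δ ^ t)⁻¹ * ℓ ^ t / 2) := by
              rw [← ENNReal.ofReal_mul (by positivity), Real.div_rpow hℓ0.le hri.le]
              congr 1
              have : 0 < r i ^ t := by positivity
              field_simp
      have hcard := card_filter_inter_Icc_le_two F hab hdisj hS
        fun i hi => hℓδ.trans_le ((hδ i hi).trans (hrab i hi))
      calc ∑ i ∈ F, ENNReal.ofReal (p i) * m {s | consSeq i s ∈ codeVal g ⁻¹' S}
          = ∑ i ∈ F.filter fun i => (S ∩ Icc (a i) (b i)).Nonempty,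
              ENNReal.ofReal (p i) * m {s | consSeq i s ∈ codeVal g ⁻¹' S} := by
            rw [Finset.sum_filter]
            refine Finset.sum_congr rfl fun i hi => ?_
            split_ifs with h
            · rfl
            · rw [hzero i hi h, mul_zero]
        _ ≤ (F.filter fun i => (S ∩ Icc (a i) (b i)).Nonempty).card •
              ENNReal.ofReal ((δ ^ t)⁻¹ * ℓ ^ t / 2) :=
            Finset.sum_le_card_nsmul _ _ _ fun i hi => hmain i (Finset.mem_filter.1 hi).1
        _ ≤ 2 • ENNReal.ofReal ((δ ^ t)⁻¹ * ℓ ^ t / 2) := by gcongr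
        _ = ENNReal.ofReal ((δ ^ t)⁻¹ * ℓ ^ t) := by
            rw [← ENNReal.ofReal_nsmul]
            congr 1
            simp only [nsmul_eq_mul]
            push_cast
            ring
  intro ℓ hℓ S hS
  obtain ⟨n, hn⟩ := exists_pow_lt_of_lt_one (div_pos hℓ hδ0) (by norm_num : (1 / 2 : ℝ) < 1)
  refine hind n ℓ hℓ ?_ S hS
  rw [lt_div_iff₀ hδ0] at hn
  linarith

/-- The mass distribution principle. -/
theorem le_dimMeasure_of_exists_forall_le {μ : Measure ℝ} {t : ℝ} (ht : 0 < t)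
    (h : ∃ M : ℝ, 0 < M ∧ ∀ ℓ : ℝ, 0 < ℓ → ∀ S : Set ℝ, (∀ x ∈ S, ∀ y ∈ S, |x - y| ≤ ℓ) →
      μ S ≤ ENNReal.ofReal (M * ℓ ^ t)) :
    ENNReal.ofReal t ≤ dimMeasure μ := by
  obtain ⟨M, hM, h⟩ := h
  refine le_iInf₂ fun A hA => ?_
  have hM0 : ENNReal.ofReal M ≠ 0 := by simpa using hM
  have hle : (ENNReal.ofReal M)⁻¹ • μ ≤ μH[t] := by
    refine Measure.le_hausdorffMeasure t _ 1 one_pos fun S hS => ?_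
    have hfin : Metric.ediam S ≠ ⊤ := ne_top_of_le_ne_top ENNReal.one_ne_top hS
    set d := (Metric.ediam S).toReal with hd
    have hd0 : 0 ≤ d := ENNReal.toReal_nonneg
    have hdiam : ∀ x ∈ S, ∀ y ∈ S, |x - y| ≤ d := fun x hx y hy =>
      Metric.dist_le_diam_of_mem' hfin hx hy
    have hlim : Tendsto (fun ℓ : ℝ => ENNReal.ofReal (M * ℓ ^ t)) (𝓝[>] d)
        (𝓝 (ENNReal.ofReal (M * d ^ t))) := by
      refine ENNReal.tendsto_ofReal (Tendsto.const_mul _ ?_)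
      exact (Real.continuousAt_rpow_const d t (Or.inr ht.le)).tendsto.mono_left nhdsWithin_le_nhds
    have hS' : μ S ≤ ENNReal.ofReal (M * d ^ t) := by
      refine ge_of_tendsto hlim ?_
      filter_upwards [self_mem_nhdsWithin] with ℓ hℓ
      exact h ℓ (hd0.trans_lt hℓ) S fun x hx y hy => (hdiam x hx y hy).trans (le_of_lt hℓ)
    rw [Measure.smul_apply, smul_eq_mul, mul_comm, ← div_eq_mul_inv]
    refine ENNReal.div_le_of_le_mul' (hS'.trans (le_of_eq ?_))
    rw [ENNReal.ofReal_mul hM.le, ← ENNReal.ofReal_rpow_of_nonneg hd0 ht.le, hd,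
      ENNReal.ofReal_toReal hfin]
  refine le_dimH_of_hausdorffMeasure_ne_zero (d := t.toNNReal) fun h0 => ?_
  rw [Real.coe_toNNReal t ht.le] at h0
  have h1 := hle A
  rw [h0, Measure.smul_apply, hA, smul_eq_mul, mul_one, nonpos_iff_eq_zero,
    ENNReal.inv_eq_zero] at h1
  exact ENNReal.ofReal_ne_top h1

/-- **Sharpness of the interval-length decay condition** (Section 6): for a countable
full-branch expanding map `T` with branches `Tb n : [a n, b n] → [0,1]` (inverse branches
`g n`), such that some iterate is uniformly expanding and the Rényi condition holds, if
`∑_n |I_n|^s = ∞ for every `s < 1`, then there is no dimension gap: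
`sup_p dim μ_p = 1`, and for every `t ∈ (0,1)` there are finitely supported probability
vectors `p` with `dim μ_p ≥ t`. -/
theorem no_dimension_gap_of_slow_decay
    (a b : ℕ+ → ℝ) (Tb : ℕ+ → ℝ → ℝ) (g : ℕ+ → ℝ → ℝ) (T : ℝ → ℝ)
    (hab : ∀ n, a n < b n) (hsub : ∀ n, 0 ≤ a n ∧ b n ≤ 1)
    (hdisj : ∀ n m : ℕ+, n ≠ m →
      Disjoint (Set.Ioo (a n) (b n)) (Set.Ioo (a m) (b m)))
    (hcover : Set.Ioo (0 : ℝ) 1 ⊆ ⋃ n : ℕ+, Set.Icc (a n) (b n))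
    (hC2 : ∀ n, ContDiff ℝ 2 (Tb n))
    (hbij : ∀ n, Set.BijOn (Tb n) (Set.Icc (a n) (b n)) (Set.Icc 0 1))
    (hexp : ∀ n, ∀ x ∈ Set.Icc (a n) (b n), 1 < |deriv (Tb n) x|)
    (hginv : ∀ n, Set.MapsTo (g n) (Set.Icc 0 1) (Set.Icc (a n) (b n)) ∧
      ∀ y ∈ Set.Icc (0 : ℝ) 1, Tb n (g n y) = y)
    (hT0 : T 0 = 0)
    (hTbranch : ∀ n, ∀ x ∈ Set.Ioo (a n) (b n), T x = Tb n x)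
    (hunif : ∃ l : ℕ, ∃ Λ : ℝ, 1 < Λ ∧
      ∀ (w : Fin l → ℕ+) (x : Fin (l + 1) → ℝ), x 0 ∈ Set.Icc (0 : ℝ) 1 →
        (∀ k : Fin l, x k.castSucc ∈ Set.Icc (a (w k)) (b (w k)) ∧
          Tb (w k) (x k.castSucc) = x k.succ) →
        Λ ≤ |∏ k : Fin l, deriv (Tb (w k)) (x k.castSucc)|)
    (hrenyi : ∃ κ : ℝ, ∀ n, ∀ x ∈ Set.Icc (a n) (b n), ∀ y ∈ Set.Icc (a n) (b n),
      ∀ z ∈ Set.Icc (a n) (b n),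
        |deriv (deriv (Tb n)) x| ≤ κ * (|deriv (Tb n) y| * |deriv (Tb n) z|))
    (hfail : ∀ s : ℝ, s < 1 → ¬ Summable (fun n : ℕ+ => (b n - a n) ^ s)) :
    sSup {d : ℝ≥0∞ | ∃ (p : ℕ+ → ℝ) (m : Measure (ℕ → ℕ+)),
        IsProbVec p ∧ IsProbabilityMeasure m ∧ IsBernoulli p m ∧
        d = dimMeasure (m.map (codeVal g))} = 1 ∧
      ∀ t ∈ Set.Ioo (0 : ℝ) 1,
        ∃ (p : ℕ+ → ℝ) (m : Measure (ℕ → ℕ+)),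
          IsProbVec p ∧ (∃ N : ℕ+, ∀ n : ℕ+, N < n → p n = 0) ∧
          IsProbabilityMeasure m ∧ IsBernoulli p m ∧
          ENNReal.ofReal t ≤ dimMeasure (m.map (codeVal g)) := by
  have hfinite : ∀ t ∈ Set.Ioo (0 : ℝ) 1,
        ∃ (p : ℕ+ → ℝ) (m : Measure (ℕ → ℕ+)),
          IsProbVec p ∧ (∃ N : ℕ+, ∀ n : ℕ+, N < n → p n = 0) ∧
          IsProbabilityMeasure m ∧ IsBernoulli p m ∧
          ENNReal.ofReal t ≤ dimMeasure (m.map (codeVal g)) := by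
    classical
    rintro t ⟨ht0, ht1⟩
    obtain ⟨κ, hκ⟩ := hrenyi
    have hlen : ∀ n, 0 < b n - a n := fun n => sub_pos.2 (hab n)
    set K : ℝ := 2 * (1 + |κ|) with hK
    have hK2 : 2 ≤ K := by linarith [abs_nonneg κ]
    have hK0 : 0 < K := by linarith
    obtain ⟨F, hF⟩ : ∃ F : Finset ℕ+, 2 * K ^ t < ∑ n ∈ F, (b n - a n) ^ t := by
      by_contra! hcon
      exact hfail t ht1 (summable_of_sum_le (fun n => Real.rpow_nonneg (hlen n).le t) hcon)
    set Z : ℝ := ∑ n ∈ F, (b n - a n) ^ t with hZ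
    have hZ0 : 0 < Z := lt_trans (by positivity) hF
    set p : ℕ+ → ℝ := fun n => if n ∈ F then (b n - a n) ^ t / Z else 0 with hpdef
    have hp0 : ∀ n, 0 ≤ p n := fun n => by
      have := Real.rpow_nonneg (hlen n).le t
      simp only [hpdef]
      split_ifs
      · positivity
      · exact le_rfl
    have hpF : ∀ n ∉ F, p n = 0 := fun n hn => by simp [hpdef, hn]
    have hpsum : ∑ n ∈ F, p n = 1 := by
      rw [Finset.sum_congr rfl fun n hn => if_pos hn, ← Finset.sum_div, ← hZ, div_self hZ0.ne']
    have := isProbabilityMeasure_symbolMeasure hp0 hpsum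
    refine ⟨p, Measure.infinitePi fun _ : ℕ => symbolMeasure F p,
      ⟨hp0, hpsum ▸ hasSum_sum_of_ne_finset_zero hpF⟩,
      ⟨F.sup id, fun n hn => hpF n fun hnF => hn.not_ge (Finset.le_sup (f := id) hnF)⟩,
      inferInstance, isBernoulli_infinitePi_symbolMeasure hp0 hpF, ?_⟩
    choose θ hθ0 hθ1 hθ using fun n => exists_abs_sub_le_of_one_lt_abs_deriv (hab n)
      ((hC2 n).of_le (by norm_num)) (hexp n)
    obtain ⟨ϑ, hϑ0, hϑ1, hϑ⟩ : ∃ ϑ : ℝ, 0 ≤ ϑ ∧ ϑ < 1 ∧ ∀ i ∈ F, θ i ≤ ϑ := by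
      rcases F.eq_empty_or_nonempty with hFe | hFne
      · exact ⟨0, le_rfl, one_pos, by simp [hFe]⟩
      · obtain ⟨i, hi, hmax⟩ := F.exists_max_image θ hFne
        exact ⟨θ i, hθ0 i, hθ1 i, hmax⟩
    refine le_dimMeasure_of_exists_forall_le ht0 (exists_map_codeVal_le (θ := ϑ)
      (r := fun n => (b n - a n) / K) hab hsub hdisj (fun n => (hginv n).1) ht0
      hϑ0 hϑ1 ?_ (fun i _ => div_pos (hlen i) hK0) ?_ ?_ ?_ ?_)
    · intro i hi x hx y hy
      have h := hθ i _ ((hginv i).1 hx) _ ((hginv i).1 hy)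
      rw [(hginv i).2 x hx, (hginv i).2 y hy] at h
      exact h.trans (mul_le_mul_of_nonneg_right (hϑ i hi) (abs_nonneg _))
    · intro i _
      rw [div_le_iff₀ hK0]
      linarith [(hsub i).1, (hsub i).2]
    · intro i _
      exact div_le_self (hlen i).le (by linarith)
    · intro i _ x hx y hy
      have h := abs_sub_le_of_renyi (hab i) (hC2 i) (hbij i).mapsTo (hκ i)
        _ ((hginv i).1 hx) _ ((hginv i).1 hy)
      rw [(hginv i).2 x hx, (hginv i).2 y hy, div_mul_eq_mul_div, le_div_iff₀ (hlen i)] at h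
      rw [div_mul_eq_mul_div, div_le_iff₀ hK0, hK]
      nlinarith [abs_nonneg (g i x - g i y), abs_nonneg κ]
    · intro i hi
      have h : 0 ≤ (b i - a i) ^ t := Real.rpow_nonneg (hlen i).le t
      have hKt : 0 < K ^ t := by positivity
      simp only [hpdef, if_pos hi]
      rw [Real.div_rpow (hlen i).le hK0.le, div_div]
      gcongr
      linarith
  refine ⟨le_antisymm (sSup_le ?_) (le_of_forall_lt fun c hc => ?_), hfinite⟩
  · rintro d ⟨p, m, -, hm, -, rfl⟩
    have := Measure.isProbabilityMeasure_map (μ := m) (measurable_codeVal g).aemeasurable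
    exact (iInf₂_le univ measure_univ).trans Real.dimH_univ.le
  · obtain ⟨t, hct, ht1⟩ := ENNReal.lt_iff_exists_real_btwn.1 hc |>.imp fun t h => h.2
    have ht0 : 0 < t := by
      by_contra! hneg
      simp [ENNReal.ofReal_of_nonpos hneg] at hct
    rw [ENNReal.ofReal_lt_one] at ht1
    obtain ⟨p, m, hp, -, hm, hB, hd⟩ := hfinite t ⟨ht0, ht1⟩
    exact hct.trans_le (hd.trans (le_sSup ⟨p, m, hp, hm, hB, rfl⟩))
end
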